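/- Let G be a finite group, N ⊴ G a π-group, θ ∈ Irr(N) G-invariant, and χ ∈ Irr(G) a character lying over a G-invariant μ ∈ Irr(N) with (χ(1)/μ(1))_π = |G/N|_π. Define ψ(g) = θ(g_π)χ(g_{π'}) if g_π ∈ N, and ψ(g) = 0 otherwise. Then ψ is a generalized character of G (an integer linear combination of irreducible characters of G). -/

import Mathlib

open scoped BigOperators
noncomputable section

open Classical in
/-- The `π`-part of a natural number: the product of prime powers in its
factorization whose primes lie in `π`. -/
def Nat.piPart (π : Set ℕ) (n : ℕ) : ℕ :=
  n.factorization.prod fun p k => if p ∈ π then p ^ k else 1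

/-- `n` is a `π`-number if every prime dividing `n` lies in `π`. -/
def IsPiNumber (π : Set ℕ) (n : ℕ) : Prop :=
  ∀ p : ℕ, p.Prime → p ∣ n → p ∈ π

/-- The `π`-part of an element of a finite group: the unique power of `g`
whose order is a `π`-number and whose complementary part has `π'`-order. -/
def elemPiPart (π : Set ℕ) {G : Type} [Group G] (g : G) : G :=
  g ^ ((orderOf g / Nat.piPart π (orderOf g)) ^ Nat.totient (Nat.piPart π (orderOf g)))

/-- `χ` is the character of some finite-dimensional complex representation of `G`. -/
def IsChar (G : Type) [Group G] (χ : G → ℂ) : Prop :=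
  ∃ V : FDRep ℂ G, ∀ g : G, χ g = V.character g

/-- The usual inner product of complex class functions. -/
def charInner (G : Type) [Group G] (φ ψ : G → ℂ) : ℂ :=
  (Nat.card G : ℂ)⁻¹ * ∑ᶠ g : G, φ g * starRingEnd ℂ (ψ g)

/-- An irreducible character: a character of norm one. -/
def IsIrrChar (G : Type) [Group G] (χ : G → ℂ) : Prop :=
  IsChar G χ ∧ charInner G χ χ = 1

/-- A class function. -/
def IsClassFun (G : Type) [Group G] (φ : G → ℂ) : Prop :=
  ∀ g h : G, φ (h * g * h⁻¹) = φ g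

/-- A virtual (generalized) character: a difference of two characters. -/
def IsGenChar (G : Type) [Group G] (ψ : G → ℂ) : Prop :=
  ∃ α β : G → ℂ, IsChar G α ∧ IsChar G β ∧ ψ = α - β

/-- `θ`, a character of the normal subgroup `N` of `G`, is `G`-invariant. -/
def IsGInvariant {G : Type} [Group G] (N : Subgroup G) [hN : N.Normal]
    (θ : ↥N → ℂ) : Prop :=
  ∀ (g : G) (n : ↥N), θ ⟨g * (n : G) * g⁻¹, hN.conj_mem (n : G) n.2 g⟩ = θ n

/-- π-defect zero irreducible characters of a group `Q`. -/
def dzSet (π : Set ℕ) (Q : Type) [Group Q] : Set (Q → ℂ) :=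
  {χ | IsIrrChar Q χ ∧ ∃ d : ℕ, χ 1 = (d : ℂ) ∧
    Nat.piPart π d = Nat.piPart π (Nat.card Q)}

/-- Irreducible characters of `G` lying over `θ ∈ Irr N` of relative π-defect zero. -/
def rdzSet (π : Set ℕ) (G : Type) [Group G] (N : Subgroup G) (θ : ↥N → ℂ) :
    Set (G → ℂ) :=
  {χ | IsIrrChar G χ ∧ charInner ↥N (fun n : ↥N => χ (n : G)) θ ≠ 0 ∧
    ∃ m : ℕ, χ 1 = θ 1 * (m : ℂ) ∧ Nat.piPart π m = Nat.piPart π N.index}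

section

open Module

theorem exists_trace_pow_eq_sum {V : Type*} [AddCommGroup V] [Module ℂ V] [FiniteDimensional ℂ V]
    {A : Module.End ℂ V} {N : ℕ} (hN : N ≠ 0) (hA : A ^ N = 1) :
    ∃ (s : Finset ℂ) (c : ℂ → ℕ), (∀ z ∈ s, z ^ N = 1) ∧
      ∀ j : ℕ, LinearMap.trace ℂ V (A ^ j) = ∑ z ∈ s, (c z : ℂ) * z ^ j := by
  have hss : A.IsSemisimple := by
    refine Module.End.isSemisimple_of_squarefree_aeval_eq_zero (p := Polynomial.X ^ N - 1) ?_ ?_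
    · exact ((Polynomial.separable_X_pow_sub_C (1 : ℂ) (by exact_mod_cast hN)
        one_ne_zero)).squarefree
    · simp [hA]
  have hint : DirectSum.IsInternal A.eigenspace :=
    DirectSum.isInternal_submodule_of_iSupIndep_of_iSup_eq_top A.eigenspaces_iSupIndep
      (Module.End.IsSemisimple.iSup_eigenspace_eq_top hss)
  have hfin : {z | A.eigenspace z ≠ ⊥}.Finite :=
    WellFoundedGT.finite_ne_bot_of_iSupIndep hint.submodule_iSupIndep
  have hpow (j : ℕ) (z : ℂ) (v : V) (hv : v ∈ A.eigenspace z) : (A ^ j) v = z ^ j • v := by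
    rw [Module.End.mem_eigenspace_iff] at hv
    induction j with
    | zero => simp
    | succ k ih => rw [pow_succ', Module.End.mul_apply, ih, map_smul, hv, smul_smul, pow_succ]
  refine ⟨hfin.toFinset, fun z ↦ finrank ℂ (A.eigenspace z), fun z hz ↦ ?_, fun j ↦ ?_⟩
  · obtain ⟨v, hv, h0⟩ := Submodule.exists_mem_ne_zero_of_ne_bot ((hfin.mem_toFinset).1 hz)
    have := hpow N z v hv
    rw [hA, Module.End.one_apply] at this
    have h2 : (z ^ N - 1) • v = 0 := by rw [sub_smul, ← this, one_smul, sub_self]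
    exact sub_eq_zero.1 ((smul_eq_zero.1 h2).resolve_right h0)
  · have hmaps (z : ℂ) : Set.MapsTo (A ^ j) (A.eigenspace z) (A.eigenspace z) := fun v hv ↦ by
      rw [hpow j z v hv]; exact Submodule.smul_mem _ _ hv
    rw [LinearMap.trace_eq_sum_trace_restrict' hint hfin hmaps]
    refine Finset.sum_congr rfl fun z _ ↦ ?_
    have : (A ^ j).restrict (hmaps z) = z ^ j • LinearMap.id := by
      ext v; exact hpow j z v v.2
    rw [this, map_smul, LinearMap.trace_id, smul_eq_mul, mul_comm]

theorem isIntegral_trace_of_isIntegral {V : Type*} [AddCommGroup V] [Module ℂ V]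
    [FiniteDimensional ℂ V] {A : Module.End ℂ V} (hA : IsIntegral ℤ A) :
    IsIntegral ℤ (LinearMap.trace ℂ V A) := by
  rw [Module.End.trace_eq_sum_roots_charpoly_of_splits (IsAlgClosed.splits _)]
  refine IsIntegral.multiset_sum fun z hz ↦ ?_
  have hz' : A.HasEigenvalue z := (Module.End.hasEigenvalue_iff_isRoot_charpoly A z).2
    (Polynomial.isRoot_of_mem_roots hz)
  obtain ⟨v, hv⟩ := hz'.exists_hasEigenvector
  obtain ⟨q, hq, h0⟩ := hA
  refine ⟨q, hq, ?_⟩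
  have h1 := Module.End.aeval_apply_of_hasEigenvector (p := q.map (Int.castRingHom ℂ)) hv
  have h2 : Polynomial.aeval A (q.map (Int.castRingHom ℂ)) = 0 := by
    rw [← h0, ← algebraMap_int_eq, Polynomial.aeval_map_algebraMap]; rfl
  rw [h2, LinearMap.zero_apply] at h1
  have := (smul_eq_zero.1 h1.symm).resolve_right hv.2
  rwa [Polynomial.eval_map] at this

theorem isIntegral_of_pow_eq_one' {R : Type*} [Ring R] {A : R} {N : ℕ} (hN : N ≠ 0)
    (hA : A ^ N = 1) : IsIntegral ℤ A :=
  ⟨Polynomial.X ^ N - 1, Polynomial.monic_X_pow_sub_C 1 hN, by simp [hA]⟩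

end

section

open Module

/-- A representation is irreducible if it is nonzero and has no proper nonzero invariant
subspaces. -/
def Representation.Irred {G V : Type*} [Group G] [AddCommGroup V] [Module ℂ V]
    (ρ : Representation ℂ G V) : Prop :=
  Nontrivial V ∧ ∀ p : Submodule ℂ V, (∀ g, ∀ v ∈ p, ρ g v ∈ p) → p = ⊥ ∨ p = ⊤

namespace Representation

variable {G V W : Type*} [Group G] [AddCommGroup V] [Module ℂ V]
  [AddCommGroup W] [Module ℂ W] {ρ : Representation ℂ G V} {σ : Representation ℂ G W}

theorem Irred.eq_smul_one [FiniteDimensional ℂ V] (h : ρ.Irred) {T : Module.End ℂ V}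
    (hT : ∀ g, Commute T (ρ g)) : ∃ c : ℂ, T = c • (1 : Module.End ℂ V) := by
  have := h.1
  obtain ⟨c, hc⟩ := Module.End.exists_eigenvalue T
  refine ⟨c, ?_⟩
  have h1 : T.eigenspace c = ⊤ := (h.2 _ fun g v hv ↦ by
    rw [Module.End.mem_eigenspace_iff] at hv ⊢
    rw [← Module.End.mul_apply, (hT g).eq, Module.End.mul_apply, hv, map_smul]).resolve_left hc
  ext v
  have : v ∈ T.eigenspace c := h1 ▸ Submodule.mem_top
  simpa using Module.End.mem_eigenspace_iff.1 this

theorem Irred.injective (h : ρ.Irred) {f : V →ₗ[ℂ] W} (hf : ∀ g v, f (ρ g v) = σ g (f v))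
    (h0 : f ≠ 0) : Function.Injective f := by
  rw [← LinearMap.ker_eq_bot]
  refine (h.2 _ fun g v hv ↦ ?_).resolve_right fun h1 ↦ h0 (LinearMap.ker_eq_top.1 h1)
  rw [LinearMap.mem_ker] at hv ⊢
  rw [hf, hv, map_zero]

theorem Irred.surjective (h : σ.Irred) {f : V →ₗ[ℂ] W} (hf : ∀ g v, f (ρ g v) = σ g (f v))
    (h0 : f ≠ 0) : Function.Surjective f := by
  rw [← LinearMap.range_eq_top]
  refine (h.2 _ fun g v hv ↦ ?_).resolve_left fun h1 ↦ h0 (LinearMap.range_eq_bot.1 h1)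
  obtain ⟨w, rfl⟩ := hv
  exact ⟨ρ g w, hf g w⟩

theorem exists_invariant_projection [Finite G] (ρ : Representation ℂ G V) (p : Submodule ℂ V)
    (hp : ∀ g, ∀ v ∈ p, ρ g v ∈ p) :
    ∃ E : Module.End ℂ V, (∀ g, Commute E (ρ g)) ∧ (∀ v, E v ∈ p) ∧ ∀ v ∈ p, E v = v := by
  have := Fintype.ofFinite G
  obtain ⟨f, hf⟩ := p.subtype.exists_leftInverse_of_injective (by simp)
  let P : Module.End ℂ V := p.subtype ∘ₗ f
  have hPp (v : V) : P v ∈ p := (f v).2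
  have hPid (v : V) (hv : v ∈ p) : P v = v :=
    congrArg Subtype.val (LinearMap.congr_fun hf ⟨v, hv⟩)
  have hcard : (Fintype.card G : ℂ) ≠ 0 := by simp
  refine ⟨(Fintype.card G : ℂ)⁻¹ • ∑ g, ρ g * P * ρ g⁻¹, fun g ↦ ?_, fun v ↦ ?_, fun v hv ↦ ?_⟩
  · refine Commute.smul_left ?_ _
    show _ * _ = _ * _
    rw [Finset.sum_mul, Finset.mul_sum]
    refine Fintype.sum_equiv (Equiv.mulLeft g⁻¹) _ _ fun x ↦ ?_
    simp only [Equiv.coe_mulLeft, ← mul_assoc, ← map_mul, mul_inv_rev, inv_inv, mul_inv_cancel,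
      one_mul]
    simp only [mul_assoc, ← map_mul]
  · simp only [LinearMap.smul_apply, LinearMap.sum_apply, Module.End.mul_apply]
    exact p.smul_mem _ (p.sum_mem fun g _ ↦ hp _ _ (hPp _))
  · simp only [LinearMap.smul_apply, LinearMap.sum_apply, Module.End.mul_apply]
    rw [Finset.sum_congr rfl fun g _ ↦ by
      rw [hPid _ (hp _ _ hv), ← Module.End.mul_apply, ← map_mul, mul_inv_cancel, map_one,
        Module.End.one_apply]]
    rw [Finset.sum_const, Finset.card_univ, ← Nat.cast_smul_eq_nsmul ℂ, smul_smul,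
      inv_mul_cancel₀ hcard, one_smul]

theorem irred_of_finrank_eq_one [Finite G] [Nontrivial V]
    (h : ∀ T : Module.End ℂ V, (∀ g, Commute T (ρ g)) → ∃ c : ℂ, T = c • (1 : Module.End ℂ V)) :
    ρ.Irred := by
  refine ⟨inferInstance, fun p hp ↦ ?_⟩
  obtain ⟨E, hE, hEp, hEid⟩ := exists_invariant_projection ρ p hp
  obtain ⟨c, rfl⟩ := h E hE
  by_cases hpb : p = ⊥
  · exact Or.inl hpb
  · right
    obtain ⟨v, hv, h0⟩ := Submodule.exists_mem_ne_zero_of_ne_bot hpb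
    have h1 : c • v = v := hEid v hv
    have hc : c = 1 := by
      have : (c - 1) • v = 0 := by rw [sub_smul, h1, one_smul, sub_self]
      exact sub_eq_zero.1 ((smul_eq_zero.1 this).resolve_right h0)
    rw [eq_top_iff]
    intro w _
    simpa [hc] using hEp w

variable [FiniteDimensional ℂ V] [FiniteDimensional ℂ W]

theorem irred_of_char_norm_one [Fintype G]
    (h : (Nat.card G : ℂ)⁻¹ * ∑ g : G, ρ.character g * ρ.character g⁻¹ = 1) : ρ.Irred := by
  have := invertibleOfNonzero (NeZero.ne (Nat.card G : ℂ))
  rw [card_inv_mul_sum_char_mul_char_eq_finrank] at h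
  have h1 : finrank ℂ (IntertwiningMap ρ ρ) = 1 := by exact_mod_cast h
  have hnt : Nontrivial V := by
    by_contra hV
    rw [not_nontrivial_iff_subsingleton] at hV
    have : Subsingleton (IntertwiningMap ρ ρ) := ⟨fun a b ↦ by ext v; exact Subsingleton.elim _ _⟩
    rw [finrank_zero_of_subsingleton] at h1
    omega
  refine irred_of_finrank_eq_one fun T hT ↦ ?_
  have hid : IntertwiningMap.id ρ ≠ 0 := fun h0 ↦ by
    obtain ⟨v, hv⟩ := exists_ne (0 : V)
    exact hv (congrArg (fun f : IntertwiningMap ρ ρ ↦ f v) h0)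
  obtain ⟨c, hc⟩ := (finrank_eq_one_iff_of_nonzero' _ hid).1 h1
    ⟨T, fun g ↦ (hT g).eq⟩
  refine ⟨c, ?_⟩
  have := congrArg IntertwiningMap.toLinearMap hc
  exact this.symm

theorem exists_intertwining_ne_zero [Fintype G]
    (h : (Nat.card G : ℂ)⁻¹ * ∑ g : G, σ.character g * ρ.character g⁻¹ ≠ 0) :
    ∃ f : V →ₗ[ℂ] W, (∀ g v, f (ρ g v) = σ g (f v)) ∧ f ≠ 0 := by
  have := invertibleOfNonzero (NeZero.ne (Nat.card G : ℂ))
  rw [card_inv_mul_sum_char_mul_char_eq_finrank] at h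
  have : Nontrivial (IntertwiningMap ρ σ) := by
    by_contra hV
    rw [not_nontrivial_iff_subsingleton] at hV
    exact h (by rw [finrank_zero_of_subsingleton, Nat.cast_zero])
  obtain ⟨f, hf⟩ := exists_ne (0 : IntertwiningMap ρ σ)
  refine ⟨f.toLinearMap, f.isIntertwining, fun h0 ↦ hf ?_⟩
  ext1; exact h0

theorem char_inv_eq_conj [Finite G] (ρ : Representation ℂ G V) (g : G) :
    ρ.character g⁻¹ = starRingEnd ℂ (ρ.character g) := by
  have hN : Nat.card G ≠ 0 := Nat.card_pos.ne'
  obtain ⟨s, c, hs, htr⟩ := exists_trace_pow_eq_sum (A := ρ g) hN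
    (by rw [← map_pow, pow_card_eq_one', map_one])
  have h1 : ρ.character g = ∑ z ∈ s, (c z : ℂ) * z := by
    simpa [character] using htr 1
  have h2 : ρ.character g⁻¹ = ∑ z ∈ s, (c z : ℂ) * z ^ (Nat.card G - 1) := by
    rw [← htr, ← map_pow]
    congr 2
    rw [inv_eq_iff_mul_eq_one, ← pow_succ', Nat.sub_add_cancel (Nat.pos_of_ne_zero hN),
      pow_card_eq_one']
  rw [h1, h2, map_sum]
  refine Finset.sum_congr rfl fun z hz ↦ ?_
  rw [map_mul, Complex.conj_natCast]
  congr 1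
  have hz1 : ‖z‖ = 1 := Complex.norm_eq_one_of_pow_eq_one (hs z hz) hN
  rw [← Complex.inv_eq_conj hz1]
  refine eq_inv_of_mul_eq_one_left ?_
  rw [← pow_succ, Nat.sub_add_cancel (Nat.pos_of_ne_zero hN), hs z hz]

theorem isIntegral_character [Finite G] (ρ : Representation ℂ G V) (g : G) :
    IsIntegral ℤ (ρ.character g) :=
  isIntegral_trace_of_isIntegral <| isIntegral_of_pow_eq_one' (N := Nat.card G)
    Nat.card_pos.ne' (by rw [← map_pow, pow_card_eq_one', map_one])

/-- Irreducible representations with the same character are isomorphic. -/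
theorem Irred.exists_equiv [Finite G] (hρ : ρ.Irred) (hσ : σ.Irred)
    (h : ρ.character = σ.character) :
    ∃ e : V ≃ₗ[ℂ] W, ∀ g v, e (ρ g v) = σ g (e v) := by
  have := Fintype.ofFinite G
  have := invertibleOfNonzero (NeZero.ne (Nat.card G : ℂ))
  have h1 : (Nat.card G : ℂ)⁻¹ * ∑ g : G, σ.character g * ρ.character g⁻¹ ≠ 0 := by
    rw [← h, card_inv_mul_sum_char_mul_char_eq_finrank]
    have : Nontrivial (IntertwiningMap ρ ρ) := ⟨⟨IntertwiningMap.id ρ, 0, fun h0 ↦ by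
      have := hρ.1
      obtain ⟨v, hv⟩ := exists_ne (0 : V)
      exact hv (congrArg (fun f : IntertwiningMap ρ ρ ↦ f v) h0)⟩⟩
    have hfin : FiniteDimensional ℂ (IntertwiningMap ρ ρ) :=
      Module.Finite.equiv (invariantsEquivIntertwiningMap ρ ρ)
    exact_mod_cast (finrank_pos (R := ℂ) (M := IntertwiningMap ρ ρ)).ne'
  obtain ⟨f, hf, h0⟩ := exists_intertwining_ne_zero h1
  exact ⟨LinearEquiv.ofBijective f ⟨hρ.injective hf h0, hσ.surjective hf h0⟩, hf⟩

end Representation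

end

section

open Module

namespace Representation

theorem Irred.isIrreducible {G V : Type*} [Group G] [AddCommGroup V] [Module ℂ V]
    {ρ : Representation ℂ G V} (h : ρ.Irred) : ρ.IsIrreducible where
  exists_pair_ne := by
    have := h.1
    refine ⟨⊥, ⊤, fun h0 ↦ ?_⟩
    exact bot_ne_top (α := Submodule ℂ V) (congrArg Subrepresentation.toSubmodule h0)
  eq_bot_or_eq_top p :=
    (h.2 p.toSubmodule fun g _ hv ↦ p.apply_mem_toSubmodule g hv).imp
      (fun h0 ↦ Subrepresentation.toSubmodule_injective h0)
      (fun h0 ↦ Subrepresentation.toSubmodule_injective h0)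

/-- A class function orthogonal to all irreducible characters acts as zero on every
representation. -/
theorem sum_smul_eq_zero_of_orthogonal {G : Type} [Group G] [Fintype G] {f : G → ℂ}
    (hf : ∀ g h, f (h * g * h⁻¹) = f g)
    (h0 : ∀ (V : Type) [AddCommGroup V] [Module ℂ V] [FiniteDimensional ℂ V]
      (ρ : Representation ℂ G V), ρ.Irred → ∑ g, f g * ρ.character g = 0)
    (n : ℕ) : ∀ (V : Type) [AddCommGroup V] [Module ℂ V] [FiniteDimensional ℂ V]
      (ρ : Representation ℂ G V), finrank ℂ V = n → ∑ g, f g • ρ g = 0 := by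
  induction n using Nat.strong_induction_on with
  | _ n ih =>
  intro V _ _ _ ρ hn
  by_cases hirr : ρ.Irred
  · have hcomm (x : G) : Commute (∑ g, f g • ρ g) (ρ x) := by
      show _ * _ = _ * _
      rw [Finset.sum_mul, Finset.mul_sum]
      refine Fintype.sum_equiv (MulAut.conj x⁻¹).toEquiv _ _ fun g ↦ ?_
      have h1 : f (x⁻¹ * (g * x)) = f g := by simpa [mul_assoc] using hf g x⁻¹
      simp [h1, ← map_mul, mul_assoc]
    obtain ⟨c, hc⟩ := hirr.eq_smul_one hcomm
    have := hirr.1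
    have htr : c * (finrank ℂ V : ℂ) = 0 := by
      have := congrArg (LinearMap.trace ℂ V) hc
      rw [map_sum, map_smul, LinearMap.trace_one] at this
      simp only [map_smul, smul_eq_mul] at this
      rw [← this]
      exact h0 V ρ hirr
    have hfr : (finrank ℂ V : ℂ) ≠ 0 := by exact_mod_cast (finrank_pos (R := ℂ) (M := V)).ne'
    rw [hc, (mul_eq_zero.1 htr).resolve_right hfr, zero_smul]
  · rcases subsingleton_or_nontrivial V with hV | hV
    · exact Subsingleton.elim _ _
    have hrestr (p : Submodule ℂ V) (hp : ∀ g, ∀ v ∈ p, ρ g v ∈ p) (hpt : p ≠ ⊤) (v : V)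
        (hv : v ∈ p) : (∑ g, f g • ρ g) v = 0 := by
      let s : Subrepresentation ρ := ⟨p, fun g v hv ↦ hp g v hv⟩
      have := ih (finrank ℂ p) (hn ▸ Submodule.finrank_lt hpt) p s.toRepresentation rfl
      have := congrArg Subtype.val (LinearMap.congr_fun this ⟨v, hv⟩)
      simpa [LinearMap.sum_apply, s, Subrepresentation.toRepresentation] using this
    simp only [Irred, not_and, not_forall, not_or] at hirr
    obtain ⟨p, hp, hpb, hpt⟩ := hirr hV
    obtain ⟨E, hE, hEp, hEid⟩ := exists_invariant_projection ρ p hp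
    have hq : ∀ g, ∀ v ∈ LinearMap.ker E, ρ g v ∈ LinearMap.ker E := fun g v hv ↦ by
      rw [LinearMap.mem_ker] at hv ⊢
      rw [← Module.End.mul_apply, (hE g).eq, Module.End.mul_apply, hv, map_zero]
    have hqt : LinearMap.ker E ≠ ⊤ := fun h1 ↦ hpb <| by
      rw [eq_bot_iff]
      intro v hv
      have h2 : v ∈ LinearMap.ker E := h1 ▸ Submodule.mem_top
      rw [LinearMap.mem_ker, hEid v hv] at h2
      simpa using h2
    ext v
    have h1 : (∑ g, f g • ρ g) v = (∑ g, f g • ρ g) (E v) + (∑ g, f g • ρ g) (v - E v) := by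
      rw [← map_add, add_sub_cancel]
    rw [h1, hrestr p hp hpt _ (hEp v), hrestr _ hq hqt, LinearMap.zero_apply, add_zero]
    rw [LinearMap.mem_ker, map_sub, hEid _ (hEp v), sub_self]

/-- The regular representation by right translations on functions. -/
def rightTranslation (G : Type) [Group G] : Representation ℂ G (G → ℂ) where
  toFun g := LinearMap.funLeft ℂ ℂ (· * g)
  map_one' := by ext; simp [LinearMap.funLeft]
  map_mul' g h := by ext; simp [LinearMap.funLeft, mul_assoc]

/-- Irreducible characters span the class functions. -/
theorem eq_zero_of_orthogonal {G : Type} [Group G] [Fintype G] {f : G → ℂ}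
    (hf : ∀ g h, f (h * g * h⁻¹) = f g)
    (h0 : ∀ (V : Type) [AddCommGroup V] [Module ℂ V] [FiniteDimensional ℂ V]
      (ρ : Representation ℂ G V), ρ.Irred → ∑ g, f g * ρ.character g⁻¹ = 0) : f = 0 := by
  classical
  have h1 := sum_smul_eq_zero_of_orthogonal (f := fun g ↦ f g⁻¹)
    (fun g h ↦ by simpa [mul_assoc] using hf g⁻¹ h)
    (fun V _ _ _ ρ hρ ↦ by
      rw [← h0 V ρ hρ]
      exact Fintype.sum_equiv (Equiv.inv G) _ _ fun g ↦ by simp)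
    _ (G → ℂ) (rightTranslation G) rfl
  ext x
  have h2 := congrFun (LinearMap.congr_fun h1 (Pi.single x⁻¹ 1)) 1
  simpa [LinearMap.sum_apply, rightTranslation, LinearMap.funLeft, Pi.single_apply] using h2

end Representation

open Representation

theorem IsChar.of_rep {G V : Type} [Group G] [AddCommGroup V] [Module ℂ V]
    [FiniteDimensional ℂ V] (ρ : Representation ℂ G V) : IsChar G ρ.character :=
  ⟨FDRep.of ρ, fun _ ↦ rfl⟩

theorem IsChar.zero (G : Type) [Group G] : IsChar G 0 :=
  ⟨FDRep.of (Representation.trivial ℂ G PUnit), fun g ↦ by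
    show 0 = LinearMap.trace ℂ _ _
    rw [Subsingleton.elim ((FDRep.of (Representation.trivial ℂ G PUnit)).ρ g) 0, map_zero]⟩

theorem IsChar.add {G : Type} [Group G] {a b : G → ℂ} (ha : IsChar G a) (hb : IsChar G b) :
    IsChar G (a + b) := by
  obtain ⟨V, hV⟩ := ha
  obtain ⟨W, hW⟩ := hb
  refine ⟨FDRep.of (Representation.prod V.ρ W.ρ), fun g ↦ ?_⟩
  rw [Pi.add_apply, hV, hW]
  exact (LinearMap.trace_prodMap' (V.ρ g) (W.ρ g)).symm

/-- The additive group of generalized characters. -/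
def genCharGroup (G : Type) [Group G] : AddSubgroup (G → ℂ) where
  carrier := {f | IsGenChar G f}
  zero_mem' := ⟨0, 0, IsChar.zero G, IsChar.zero G, (sub_zero 0).symm⟩
  add_mem' := by
    rintro _ _ ⟨a, b, ha, hb, rfl⟩ ⟨c, d, hc, hd, rfl⟩
    exact ⟨a + c, b + d, ha.add hc, hb.add hd, by abel⟩
  neg_mem' := by
    rintro _ ⟨a, b, ha, hb, rfl⟩
    exact ⟨b, a, hb, ha, by abel⟩

/-- A class function with integral inner products with all characters is a generalized
character. -/
theorem isGenChar_of_forall_pairing_int {G : Type} [Group G] [Fintype G] {f : G → ℂ}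
    (hf : ∀ g h, f (h * g * h⁻¹) = f g)
    (hint : ∀ (V : Type) [AddCommGroup V] [Module ℂ V] [FiniteDimensional ℂ V]
      (ρ : Representation ℂ G V),
      ∃ n : ℤ, (Nat.card G : ℂ)⁻¹ * ∑ g, f g * ρ.character g = n) : IsGenChar G f := by
  classical
  have := invertibleOfNonzero (NeZero.ne (Nat.card G : ℂ))
  let pair (b : G → ℂ) : (G → ℂ) →ₗ[ℂ] ℂ :=
    { toFun := fun a ↦ (Nat.card G : ℂ)⁻¹ * ∑ g, a g * b g⁻¹
      map_add' := fun a c ↦ by simp [add_mul, Finset.sum_add_distrib, mul_add]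
      map_smul' := fun r a ↦ by
        simp only [Pi.smul_apply, smul_eq_mul, RingHom.id_apply, mul_assoc, ← Finset.mul_sum]
        ring }
  let I : Set (G → ℂ) :=
    {χ | ∃ V : FDRep ℂ G, Representation.Irred V.ρ ∧ Representation.character V.ρ = χ}
  have horth (a : G → ℂ) (ha : a ∈ I) (b : G → ℂ) (hb : b ∈ I) :
      pair b a = if a = b then 1 else 0 := by
    obtain ⟨V, hV, rfl⟩ := ha
    obtain ⟨W, hW, rfl⟩ := hb
    have := hV.isIrreducible
    have := hW.isIrreducible
    show (Nat.card G : ℂ)⁻¹ * ∑ g, Representation.character V.ρ g *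
      Representation.character W.ρ g⁻¹ = _
    split_ifs with h
    · rw [← h, char_orthonormal, if_pos ⟨Representation.Equiv.refl _⟩]
    · rw [char_orthonormal, if_neg]
      rintro ⟨e⟩
      exact h (char_iso e).symm
  have hlin : LinearIndependent ℂ (fun a : I ↦ (a : G → ℂ)) := by
    rw [linearIndependent_iff']
    intro s c hc i hi
    have := congrArg (pair i) hc
    rw [map_sum, map_zero, Finset.sum_eq_single i] at this
    · simpa [horth _ i.2 _ i.2] using this
    · intro j _ hj
      rw [map_smul, horth _ j.2 _ i.2, if_neg (fun h ↦ hj (Subtype.ext h)), smul_zero]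
    · exact fun h ↦ absurd hi h
  have hfin : I.Finite := hlin.setFinite
  have hzero : f - ∑ a ∈ hfin.toFinset, pair a f • a = 0 := by
    refine eq_zero_of_orthogonal (fun g h ↦ ?_) fun V _ _ _ ρ hρ ↦ ?_
    · simp only [Pi.sub_apply, Finset.sum_apply, Pi.smul_apply, hf]
      congr 1
      refine Finset.sum_congr rfl fun a ha ↦ ?_
      obtain ⟨V, hV, rfl⟩ := hfin.mem_toFinset.1 ha
      rw [char_conj]
    · have h1 : pair ρ.character (f - ∑ a ∈ hfin.toFinset, pair a f • a) = 0 := by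
        have hmem : ρ.character ∈ I := ⟨FDRep.of ρ, hρ, rfl⟩
        rw [map_sub, map_sum, Finset.sum_eq_single ρ.character]
        · rw [map_smul, horth _ hmem _ hmem, if_pos rfl, smul_eq_mul, mul_one, sub_self]
        · intro b hb hne
          rw [map_smul, horth _ (hfin.mem_toFinset.1 hb) _ hmem, if_neg hne, smul_zero]
        · exact fun h ↦ absurd (hfin.mem_toFinset.2 hmem) h
      exact (mul_eq_zero.1 h1).resolve_left (inv_ne_zero (NeZero.ne _))
  rw [sub_eq_zero.1 hzero]
  refine (genCharGroup G).sum_mem fun a ha ↦ ?_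
  obtain ⟨V, hV, rfl⟩ := hfin.mem_toFinset.1 ha
  obtain ⟨n, hn⟩ := hint _ (Representation.dual V.ρ)
  have h1 : pair (Representation.character V.ρ) f = n := by
    rw [← hn]
    simp only [char_dual]; rfl
  rw [h1, Int.cast_smul_eq_zsmul]
  exact (genCharGroup G).zsmul_mem ⟨_, 0, IsChar.of_rep V.ρ, IsChar.zero G, (sub_zero _).symm⟩ n

end

section

theorem IsPiNumber.mul {π : Set ℕ} {a b : ℕ} (ha : IsPiNumber π a) (hb : IsPiNumber π b) :
    IsPiNumber π (a * b) := fun p hp h ↦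
  (hp.dvd_mul.1 h).elim (ha p hp) (hb p hp)

theorem IsPiNumber.of_dvd {π : Set ℕ} {a b : ℕ} (hb : IsPiNumber π b) (h : a ∣ b) :
    IsPiNumber π a := fun p hp hpa ↦ hb p hp (hpa.trans h)

theorem isPiNumber_one (π : Set ℕ) : IsPiNumber π 1 := fun _ hp h ↦
  absurd (Nat.dvd_one.1 h) hp.ne_one

theorem IsPiNumber.coprime {π : Set ℕ} {a b : ℕ} (ha : IsPiNumber π a) (hb : IsPiNumber πᶜ b) :
    a.Coprime b :=
  Nat.coprime_of_dvd fun p hp hpa hpb ↦ hb p hp hpb (ha p hp hpa)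

theorem Nat.exists_eq_mul_isPiNumber (π : Set ℕ) (n : ℕ) (hn : n ≠ 0) :
    ∃ a b, n = a * b ∧ IsPiNumber π a ∧ IsPiNumber πᶜ b := by
  induction n using Nat.recOnMul with
  | zero => exact absurd rfl hn
  | one => exact ⟨1, 1, rfl, isPiNumber_one π, isPiNumber_one _⟩
  | prime p hp =>
    have key (σ : Set ℕ) (h : p ∈ σ) : IsPiNumber σ p := fun q hq hqp ↦
      (Nat.prime_dvd_prime_iff_eq hq hp).1 hqp ▸ h
    by_cases h : p ∈ π
    · exact ⟨p, 1, (mul_one p).symm, key π h, isPiNumber_one _⟩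
    · exact ⟨1, p, (one_mul p).symm, isPiNumber_one _, key _ h⟩
  | mul m n ihm ihn =>
    obtain ⟨a, b, rfl, ha, hb⟩ := ihm (left_ne_zero_of_mul hn)
    obtain ⟨c, d, rfl, hc, hd⟩ := ihn (right_ne_zero_of_mul hn)
    exact ⟨a * c, b * d, by ring, ha.mul hc, hb.mul hd⟩

theorem Nat.piPart_mul {π : Set ℕ} {a b : ℕ} (ha0 : a ≠ 0) (ha : IsPiNumber π a)
    (hb : IsPiNumber πᶜ b) : Nat.piPart π (a * b) = a := by
  classical
  have h1 := Nat.factorization_mul_of_coprime (ha.coprime hb)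
  rw [Nat.piPart, h1, Finsupp.prod_add_index_of_disjoint
    ((ha.coprime hb).disjoint_primeFactors)]
  have h2 : (a.factorization.prod fun p k ↦ if p ∈ π then p ^ k else 1) = a := by
    conv_rhs => rw [← Nat.prod_factorization_pow_eq_self ha0]
    refine Finsupp.prod_congr fun p hp ↦ if_pos (ha p ?_ ?_)
    exacts [Nat.prime_of_mem_primeFactors hp, Nat.dvd_of_mem_primeFactors hp]
  have h3 : (b.factorization.prod fun p k ↦ if p ∈ π then p ^ k else 1) = 1 := by
    refine Finset.prod_eq_one fun p hp ↦ if_neg (hb p ?_ ?_)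
    exacts [Nat.prime_of_mem_primeFactors hp, Nat.dvd_of_mem_primeFactors hp]
  rw [h2, h3, mul_one]

theorem IsPiNumber.compl_compl {π : Set ℕ} {a : ℕ} (h : IsPiNumber π a) : IsPiNumber πᶜᶜ a := by
  rwa [_root_.compl_compl]

section elem
variable {G : Type} [Group G] [Finite G] {π : Set ℕ}

theorem elemPiPart_mul {u y : G} (h : Commute u y) (hu : IsPiNumber π (orderOf u))
    (hy : IsPiNumber πᶜ (orderOf y)) : elemPiPart π (u * y) = u := by
  have hc := hu.coprime hy
  have hu0 := (orderOf_pos u).ne'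
  have h1 : Nat.piPart π (orderOf u * orderOf y) = orderOf u := Nat.piPart_mul hu0 hu hy
  rw [elemPiPart, h.orderOf_mul_eq_mul_orderOf_of_coprime hc, h1,
    Nat.mul_div_cancel_left _ (orderOf_pos u), h.mul_pow]
  have h2 : u ^ orderOf y ^ (orderOf u).totient = u := by
    conv_rhs => rw [← pow_one u]
    exact pow_eq_pow_iff_modEq.2 (Nat.ModEq.pow_totient hc.symm)
  rw [h2, orderOf_dvd_iff_pow_eq_one.1 (dvd_pow_self _ (Nat.totient_pos.2 (orderOf_pos u)).ne'),
    mul_one]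

theorem elemPiPart_compl_mul {u y : G} (h : Commute u y) (hu : IsPiNumber π (orderOf u))
    (hy : IsPiNumber πᶜ (orderOf y)) : elemPiPart πᶜ (u * y) = y := by
  rw [h.eq]
  exact elemPiPart_mul h.symm hy hu.compl_compl

theorem exists_mul_eq_isPiNumber (π : Set ℕ) (g : G) : ∃ i j : ℕ, g ^ i * g ^ j = g ∧
    IsPiNumber π (orderOf (g ^ i)) ∧ IsPiNumber πᶜ (orderOf (g ^ j)) := by
  obtain ⟨a, b, hab, ha, hb⟩ := Nat.exists_eq_mul_isPiNumber π _ (orderOf_pos g).ne'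
  have hc := ha.coprime hb
  have h0 := hab ▸ (orderOf_pos g).ne'
  have ha0 := left_ne_zero_of_mul h0
  have hb0 := right_ne_zero_of_mul h0
  have hat := (Nat.totient_pos.2 (Nat.pos_of_ne_zero ha0)).ne'
  have hbt := (Nat.totient_pos.2 (Nat.pos_of_ne_zero hb0)).ne'
  refine ⟨b ^ a.totient, a ^ b.totient, ?_, ha.of_dvd ?_, hb.of_dvd ?_⟩
  · rw [← pow_add]
    conv_rhs => rw [← pow_one g]
    rw [pow_eq_pow_iff_modEq, hab]
    refine (Nat.modEq_and_modEq_iff_modEq_mul hc).1 ⟨?_, ?_⟩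
    · simpa using (Nat.ModEq.pow_totient hc.symm).add
        (Nat.modEq_zero_iff_dvd.2 (dvd_pow_self a hbt))
    · simpa using (Nat.modEq_zero_iff_dvd.2 (dvd_pow_self b hat)).add (Nat.ModEq.pow_totient hc)
  · rw [orderOf_dvd_iff_pow_eq_one, ← pow_mul, ← orderOf_dvd_iff_pow_eq_one, hab, mul_comm]
    exact mul_dvd_mul_right (dvd_pow_self b hat) _
  · rw [orderOf_dvd_iff_pow_eq_one, ← pow_mul, ← orderOf_dvd_iff_pow_eq_one, hab]
    exact mul_dvd_mul_right (dvd_pow_self a hbt) _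

theorem elemPiPart_spec (π : Set ℕ) (g : G) :
    elemPiPart π g * elemPiPart πᶜ g = g ∧ IsPiNumber π (orderOf (elemPiPart π g)) ∧
      IsPiNumber πᶜ (orderOf (elemPiPart πᶜ g)) ∧
      (∃ i : ℕ, elemPiPart π g = g ^ i) ∧ ∃ j : ℕ, elemPiPart πᶜ g = g ^ j := by
  obtain ⟨i, j, hg, hi, hj⟩ := exists_mul_eq_isPiNumber π g
  have hc : Commute (g ^ i) (g ^ j) := Commute.pow_pow_self g i j
  have h1 := elemPiPart_mul hc hi hj
  have h2 := elemPiPart_compl_mul hc hi hj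
  rw [hg] at h1 h2
  rw [h1, h2]
  exact ⟨hg, hi, hj, ⟨i, rfl⟩, j, rfl⟩

theorem elemPiPart_commute (π : Set ℕ) (g : G) :
    Commute (elemPiPart π g) (elemPiPart πᶜ g) := by
  obtain ⟨-, -, -, ⟨i, hi⟩, j, hj⟩ := elemPiPart_spec π g
  rw [hi, hj]
  exact Commute.pow_pow_self g i j

theorem elemPiPart_map {H : Type} [Group H] [Finite H] (f : G →* H) (π : Set ℕ) (g : G) :
    elemPiPart π (f g) = f (elemPiPart π g) := by
  obtain ⟨h, hi, hj, -⟩ := elemPiPart_spec π g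
  conv_lhs => rw [← h, map_mul]
  exact elemPiPart_mul ((elemPiPart_commute π g).map f) (hi.of_dvd (orderOf_map_dvd f _))
    (hj.of_dvd (orderOf_map_dvd f _))

theorem elemPiPart_conj (π : Set ℕ) (g h : G) :
    elemPiPart π (h * g * h⁻¹) = h * elemPiPart π g * h⁻¹ :=
  elemPiPart_map (MulAut.conj h).toMonoidHom π g

theorem elemPiPart_pow (π : Set ℕ) (g : G) (k : ℕ) :
    elemPiPart π (g ^ k) = elemPiPart π g ^ k := by
  obtain ⟨h, hi, hj, -⟩ := elemPiPart_spec π g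
  conv_lhs => rw [← h, (elemPiPart_commute π g).mul_pow]
  exact elemPiPart_mul ((elemPiPart_commute π g).pow_pow k k) (hi.of_dvd (orderOf_pow_dvd _))
    (hj.of_dvd (orderOf_pow_dvd _))

omit [Finite G] in
theorem IsPiNumber.orderOf_mul {u y : G} (h : Commute u y) (hu : IsPiNumber π (orderOf u))
    (hy : IsPiNumber π (orderOf y)) : IsPiNumber π (orderOf (u * y)) :=
  (hu.mul hy).of_dvd (h.orderOf_mul_dvd_mul_orderOf)

end elem

end

section

open Polynomial in
theorem exists_int_of_aeval_primitiveRoots_eq {N : ℕ} (hN : 0 < N) {Q : ℤ[X]} {c : ℂ}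
    (h : ∀ z : ℂ, IsPrimitiveRoot z N → aeval z Q = c) : ∃ n : ℤ, c = n := by
  have hm := cyclotomic.monic N ℤ
  have hc : (Q %ₘ cyclotomic N ℤ).map (Int.castRingHom ℂ) = C c := by
    have hcard := Complex.card_primitiveRoots N
    refine eq_of_degrees_lt_of_eval_finset_eq (primitiveRoots N ℂ) ?_ ?_ fun z hz ↦ ?_
    · rw [hcard, ← degree_cyclotomic N ℤ]
      exact (degree_map_le).trans_lt (degree_modByMonic_lt Q hm)
    · rw [hcard]
      exact degree_C_le.trans_lt (by exact_mod_cast Nat.totient_pos.2 hN)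
    · have hz := (mem_primitiveRoots hN).1 hz
      have h1 := h z hz
      rw [← modByMonic_add_div Q (cyclotomic N ℤ), map_add, map_mul] at h1
      have h2 : aeval z (cyclotomic N ℤ) = 0 := by
        rw [aeval_def, ← eval_map, map_cyclotomic]
        exact hz.isRoot_cyclotomic hN
      rw [h2, zero_mul, add_zero] at h1
      rw [eval_C, ← h1, aeval_def, eval_map]
      rfl
  refine ⟨(Q %ₘ cyclotomic N ℤ).coeff 0, ?_⟩
  have := congrArg (fun p ↦ coeff p 0) hc
  simpa using this.symm

/-- On exponents coprime to `N`, the sequence `F` is an integral polynomial in the powers of a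
primitive `N`-th root of unity. -/
def IsGaloisSeq (N : ℕ) (F : ℕ → ℂ) : Prop :=
  ∃ q : Polynomial ℤ, ∀ k, k.Coprime N →
    F k = Polynomial.aeval (Complex.exp (2 * Real.pi * Complex.I / N) ^ k) q

namespace IsGaloisSeq
variable {N : ℕ} {F F' : ℕ → ℂ}

theorem congr (h : IsGaloisSeq N F) (hF : ∀ k, k.Coprime N → F' k = F k) : IsGaloisSeq N F' := by
  obtain ⟨q, hq⟩ := h
  exact ⟨q, fun k hk ↦ (hF k hk).trans (hq k hk)⟩

theorem zero (N : ℕ) : IsGaloisSeq N fun _ ↦ 0 := ⟨0, fun k _ ↦ by simp⟩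

theorem mul (h : IsGaloisSeq N F) (h' : IsGaloisSeq N F') :
    IsGaloisSeq N fun k ↦ F k * F' k := by
  obtain ⟨q, hq⟩ := h
  obtain ⟨q', hq'⟩ := h'
  exact ⟨q * q', fun k hk ↦ by
    rw [map_mul, ← hq k hk, ← hq' k hk]⟩

theorem character {G V : Type*} [Group G] [AddCommGroup V] [Module ℂ V]
    [FiniteDimensional ℂ V] (ρ : Representation ℂ G V) (hN : N ≠ 0) {g : G} (hg : g ^ N = 1) :
    IsGaloisSeq N fun k ↦ ρ.character (g ^ k) := by
  obtain ⟨s, c, hs, hc⟩ := exists_trace_pow_eq_sum (A := ρ g) hN (by rw [← map_pow, hg, map_one])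
  have := NeZero.mk hN
  have hex (z : ℂ) : ∃ e : ℕ, z ∈ s → Complex.exp (2 * Real.pi * Complex.I / N) ^ e = z := by
    by_cases hz : z ∈ s
    · obtain ⟨e, -, he⟩ := (Complex.isPrimitiveRoot_exp N hN).eq_pow_of_pow_eq_one (hs z hz)
      exact ⟨e, fun _ ↦ he⟩
    · exact ⟨0, fun h ↦ absurd h hz⟩
  choose e he using hex
  refine ⟨∑ z ∈ s, Polynomial.C (c z : ℤ) * Polynomial.X ^ e z, fun k _ ↦ ?_⟩
  simp only [Representation.character, map_pow]
  rw [hc, map_sum]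
  refine Finset.sum_congr rfl fun z hz ↦ ?_
  rw [map_mul, map_pow, Polynomial.aeval_X, pow_right_comm, he z hz]
  simp

end IsGaloisSeq

theorem exists_int_sum_of_isGaloisSeq {G : Type*} [Group G] [Fintype G] {f : G → ℂ}
    (h : ∀ g, IsGaloisSeq (Nat.card G) fun k ↦ f (g ^ k)) : ∃ n : ℤ, ∑ g, f g = n := by
  choose q hq using h
  have hN : Nat.card G ≠ 0 := Nat.card_pos.ne'
  refine exists_int_of_aeval_primitiveRoots_eq (N := Nat.card G) Nat.card_pos
    (Q := ∑ g, q g) fun z hz ↦ ?_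
  have := NeZero.mk hN
  obtain ⟨k, -, hk, rfl⟩ := ((Complex.isPrimitiveRoot_exp _ hN).isPrimitiveRoot_iff).1 hz
  rw [map_sum]
  refine Fintype.sum_equiv (powCoprime hk.symm) _ _ fun g ↦ ?_
  exact (hq g k hk).symm

theorem Complex.exists_int_of_isIntegral_div {n : ℤ} {m : ℕ}
    (h : IsIntegral ℤ ((m : ℂ)⁻¹ * n)) : ∃ k : ℤ, (m : ℂ)⁻¹ * n = k := by
  have h1 : (m : ℂ)⁻¹ * n = algebraMap ℚ ℂ ((m : ℚ)⁻¹ * n) := by simp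
  rw [h1, isIntegral_algebraMap_iff (algebraMap ℚ ℂ).injective] at h
  obtain ⟨k, hk⟩ := IsIntegrallyClosed.isIntegral_iff.1 h
  exact ⟨k, by rw [h1, ← hk]; simp⟩

/-- `z` is integral over the localization of `ℤ` at `p`. -/
def PInt (p : ℕ) (z : ℂ) : Prop := ∃ n : ℕ, ¬ p ∣ n ∧ IsIntegral ℤ ((n : ℂ) * z)

theorem IsIntegral.pInt {p : ℕ} (hp : p.Prime) {z : ℂ} (h : IsIntegral ℤ z) : PInt p z :=
  ⟨1, fun h1 ↦ hp.ne_one (Nat.dvd_one.1 h1), by simpa⟩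

namespace PInt
variable {p : ℕ} {z w : ℂ}

theorem add (hp : p.Prime) (hz : PInt p z) (hw : PInt p w) : PInt p (z + w) := by
  obtain ⟨n, hn, hz⟩ := hz
  obtain ⟨m, hm, hw⟩ := hw
  refine ⟨n * m, fun h ↦ (hp.dvd_mul.1 h).elim hn hm, ?_⟩
  have : ((n * m : ℕ) : ℂ) * (z + w) = m * (n * z) + n * (m * w) := by push_cast; ring
  rw [this]
  exact ((isIntegral_natCast m).mul hz).add ((isIntegral_natCast n).mul hw)

theorem mul (hp : p.Prime) (hz : PInt p z) (hw : PInt p w) : PInt p (z * w) := by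
  obtain ⟨n, hn, hz⟩ := hz
  obtain ⟨m, hm, hw⟩ := hw
  refine ⟨n * m, fun h ↦ (hp.dvd_mul.1 h).elim hn hm, ?_⟩
  have : ((n * m : ℕ) : ℂ) * (z * w) = n * z * (m * w) := by push_cast; ring
  rw [this]
  exact hz.mul hw

theorem sum (hp : p.Prime) {ι : Type*} {s : Finset ι} {F : ι → ℂ} (h : ∀ i ∈ s, PInt p (F i)) :
    PInt p (∑ i ∈ s, F i) := by
  classical
  induction s using Finset.induction_on with
  | empty => simpa using isIntegral_zero.pInt hp
  | insert a s ha ih =>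
    rw [Finset.sum_insert ha]
    exact (h a (Finset.mem_insert_self a s)).add hp
      (ih fun i hi ↦ h i (Finset.mem_insert_of_mem hi))

theorem isIntegral_of_forall (h : ∀ p : ℕ, p.Prime → PInt p z) : IsIntegral ℤ z := by
  let I : Ideal ℤ :=
    { carrier := {n | IsIntegral ℤ ((n : ℂ) * z)}
      zero_mem' := by simpa using isIntegral_zero
      add_mem' := fun {a b} ha hb ↦ by
        have : ((a + b : ℤ) : ℂ) * z = a * z + b * z := by push_cast; ring
        simpa only [Set.mem_ofPred_eq, this] using IsIntegral.add ha hb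
      smul_mem' := fun c a ha ↦ by
        have : ((c • a : ℤ) : ℂ) * z = c * (a * z) := by push_cast [smul_eq_mul]; ring
        simpa only [Set.mem_ofPred_eq, this] using
          IsIntegral.mul (by simpa using isIntegral_algebraMap (R := ℤ) (A := ℂ) (x := c)) ha }
  obtain ⟨a, ha⟩ := (IsPrincipalIdealRing.principal I).principal
  have ha' : I = Ideal.span {a} := ha
  have hunit : a.natAbs = 1 := by
    by_contra h1
    obtain ⟨p, hp, hpa⟩ := Nat.exists_prime_and_dvd h1
    obtain ⟨n, hn, hz⟩ := h p hp
    have hmem : (n : ℤ) ∈ I := by simpa [I] using hz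
    rw [ha', Ideal.mem_span_singleton] at hmem
    exact hn (hpa.trans (Int.natAbs_dvd_natAbs.2 hmem))
  have h1 : (1 : ℤ) ∈ I := by
    rw [ha', Ideal.mem_span_singleton]
    exact (Int.isUnit_iff_natAbs_eq.2 hunit).dvd
  simpa [I] using h1

end PInt

end

section

namespace Representation

variable {P V W : Type*} [Group P] [AddCommGroup V] [Module ℂ V] [FiniteDimensional ℂ V]
  [AddCommGroup W] [Module ℂ W] [FiniteDimensional ℂ W]

theorem isIntegral_average_trace_mul [Fintype P] (ρ : Representation ℂ P V) {A : Module.End ℂ V}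
    (hA : ∀ u, Commute (ρ u) A) {k : ℕ} (hk : k ≠ 0) (hAk : A ^ k = 1) :
    IsIntegral ℤ ((Nat.card P : ℂ)⁻¹ * ∑ u, LinearMap.trace ℂ V (ρ u * A)) := by
  let e : Module.End ℂ V := (Nat.card P : ℂ)⁻¹ • ∑ u, ρ u
  have hρe (u : P) : ρ u * e = e := by
    simp only [e, mul_smul_comm, Finset.mul_sum, ← map_mul]
    congr 1
    exact Fintype.sum_equiv (Equiv.mulLeft u) _ _ fun _ ↦ rfl
  have hee : e * e = e := by
    conv_lhs => enter [1]; simp only [e]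
    rw [smul_mul_assoc, Finset.sum_mul]
    simp only [hρe, Finset.sum_const, Finset.card_univ, ← Nat.card_eq_fintype_card]
    rw [← Nat.cast_smul_eq_nsmul ℂ, smul_smul, inv_mul_cancel₀ (NeZero.ne _), one_smul]
  have heA : Commute e A := (Commute.sum_left _ _ _ fun u _ ↦ hA u).smul_left _
  have htr : (Nat.card P : ℂ)⁻¹ * ∑ u, LinearMap.trace ℂ V (ρ u * A) =
      LinearMap.trace ℂ V (e * A) := by
    simp only [e, smul_mul_assoc, Finset.sum_mul, map_smul, map_sum, smul_eq_mul]
  rw [htr]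
  have hpow : (e * A) ^ (k + 1) = e * A := by
    rw [heA.mul_pow, IsIdempotentElem.pow_succ_eq (n := k) hee, pow_succ, hAk, one_mul]
  refine isIntegral_trace_of_isIntegral
    ⟨Polynomial.X ^ (k + 1) - Polynomial.X, Polynomial.monic_X_pow_sub ?_, ?_⟩
  · rw [Polynomial.degree_X]
    exact_mod_cast Nat.lt_succ_of_le (Nat.one_le_iff_ne_zero.2 hk)
  · simp [hpow]

theorem isIntegral_average_trace_mul_trace [Fintype P] (ρ : Representation ℂ P V)
    (σ : Representation ℂ P W) {A : Module.End ℂ V} {B : Module.End ℂ W}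
    (hA : ∀ u, Commute (ρ u) A) (hB : ∀ u, Commute (σ u) B) {k : ℕ} (hk : k ≠ 0)
    (hAk : A ^ k = 1) (hBk : B ^ k = 1) :
    IsIntegral ℤ ((Nat.card P : ℂ)⁻¹ *
      ∑ u, LinearMap.trace ℂ V (ρ u * A) * LinearMap.trace ℂ W (σ u * B)) := by
  have h1 := isIntegral_average_trace_mul (ρ.tprod σ) (A := TensorProduct.map A B)
    (fun u ↦ by
      show TensorProduct.map _ _ * TensorProduct.map _ _ =
        TensorProduct.map _ _ * TensorProduct.map _ _
      rw [← TensorProduct.map_mul, ← TensorProduct.map_mul, (hA u).eq, (hB u).eq]) hk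
    (by rw [TensorProduct.map_pow, hAk, hBk]; exact TensorProduct.map_id)
  convert h1 using 4 with u
  rw [tprod_apply, ← TensorProduct.map_mul]
  exact (LinearMap.trace_tensorProduct' _ _).symm

end Representation

end

section

theorem PInt.average_stabilizer {G Ω : Type} [Group G] [Finite G] [Fintype Ω] [MulAction G Ω]
    {p : ℕ} (hp : p.Prime) {w : Ω → ℂ} (hw : ∀ (g : G) ω, w (g • ω) = w ω)
    (hint : ∀ ω, PInt p (w ω)) :
    PInt p ((Nat.card G : ℂ)⁻¹ * ∑ ω, (Nat.card (MulAction.stabilizer G ω) : ℂ) * w ω) := by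
  classical
  have : Fintype (Quotient (MulAction.orbitRel G Ω)) := Fintype.ofFinite _
  have h1 (ω : Ω) : (Nat.card G : ℂ)⁻¹ * ((Nat.card (MulAction.stabilizer G ω) : ℂ) * w ω) =
      (Nat.card (MulAction.orbit G ω) : ℂ)⁻¹ * w ω := by
    have h2 : (Nat.card (MulAction.orbit G ω) : ℂ) * Nat.card (MulAction.stabilizer G ω) =
        Nat.card G := by
      rw [← Nat.cast_mul, ← Nat.card_prod]
      exact_mod_cast Nat.card_congr (MulAction.orbitProdStabilizerEquivGroup G ω)
    have h3 : (Nat.card (MulAction.stabilizer G ω) : ℂ) ≠ 0 := NeZero.ne _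
    rw [← h2, mul_inv, mul_assoc, inv_mul_cancel_left₀ h3]
  rw [Finset.mul_sum, Finset.sum_congr rfl fun ω _ ↦ h1 ω,
    ← Finset.sum_fiberwise _ (fun ω ↦ (⟦ω⟧ : Quotient (MulAction.orbitRel G Ω)))]
  refine PInt.sum hp fun q _ ↦ ?_
  induction q using Quotient.inductionOn with
  | _ ω₀ =>
  have h4 : ∀ ω ∈ Finset.univ.filter fun ω ↦ (⟦ω⟧ : Quotient (MulAction.orbitRel G Ω)) = ⟦ω₀⟧,
      (Nat.card (MulAction.orbit G ω) : ℂ)⁻¹ * w ω =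
        (Nat.card (MulAction.orbit G ω₀) : ℂ)⁻¹ * w ω₀ := fun ω hω ↦ by
    have h5 : ω ∈ MulAction.orbit G ω₀ := Quotient.exact (Finset.mem_filter.1 hω).2
    rw [MulAction.orbit_eq_iff.2 h5]
    obtain ⟨g, rfl⟩ := h5
    rw [hw]
  rw [Finset.sum_congr rfl h4, Finset.sum_const]
  have h6 : (Finset.univ.filter fun ω ↦ (⟦ω⟧ : Quotient (MulAction.orbitRel G Ω)) = ⟦ω₀⟧).card =
      Nat.card (MulAction.orbit G ω₀) := by
    rw [← Set.ncard_coe_finset, Nat.card_coe_set_eq]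
    congr 1
    ext ω
    simp only [Finset.coe_filter, Finset.mem_univ, true_and, Set.mem_ofPred_eq, Quotient.eq,
      MulAction.orbitRel_apply]
  have h7 : (Nat.card (MulAction.orbit G ω₀) : ℂ) ≠ 0 := by
    have : Nonempty (MulAction.orbit G ω₀) := ⟨⟨ω₀, MulAction.mem_orbit_self _⟩⟩
    exact NeZero.ne _
  rw [h6, ← Nat.cast_smul_eq_nsmul ℂ, smul_eq_mul, mul_inv_cancel_left₀ h7]
  exact hint ω₀

/-- A `G`-set with `p`-group stabilizers in which every `p`-element has a number of fixed points
congruent to one modulo the `p`-part of `|G|`. -/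
theorem exists_gset_card_fixedBy_modEq_one {G : Type} [Group G] [Finite G] {p : ℕ}
    (hp : p.Prime) :
    ∃ (X : Type) (_ : Fintype X) (_ : MulAction G X),
      (∀ x : X, IsPGroup p (MulAction.stabilizer G x)) ∧
      ∀ u : G, IsPGroup p (Subgroup.zpowers u) →
        Nat.card (MulAction.fixedBy X u) ≡ 1 [MOD p ^ (Nat.card G).factorization p] := by
  classical
  have := Fact.mk hp
  obtain ⟨Q⟩ : Nonempty (Sylow p G) := inferInstance
  set a := (Nat.card G).factorization p with ha
  set M := (p ^ a).totient with hM
  have hM0 : 0 < M := Nat.totient_pos.2 (pow_pos hp.pos a)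
  have : Fintype (G ⧸ (Q : Subgroup G)) := Fintype.ofFinite _
  refine ⟨Fin M → G ⧸ (Q : Subgroup G), inferInstance, inferInstance, fun x ↦ ?_, fun u hu ↦ ?_⟩
  · obtain ⟨g, hg⟩ := QuotientGroup.mk_surjective (x ⟨0, hM0⟩)
    have h1 : MulAction.stabilizer G x ≤ MulAction.stabilizer G (x ⟨0, hM0⟩) :=
      fun s hs ↦ congrFun hs ⟨0, hM0⟩
    refine IsPGroup.to_le ?_ h1
    have h2 : x ⟨0, hM0⟩ = g • ((1 : G) : G ⧸ (Q : Subgroup G)) := by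
      rw [← hg, MulAction.Quotient.smul_coe, smul_eq_mul, mul_one]
    rw [h2, MulAction.stabilizer_smul_eq_stabilizer_map_conj, MulAction.stabilizer_quotient]
    exact Q.isPGroup'.map _
  · have h1 : Nat.card (MulAction.fixedBy (Fin M → G ⧸ (Q : Subgroup G)) u) =
        Nat.card (MulAction.fixedBy (G ⧸ (Q : Subgroup G)) u) ^ M := by
      have e : MulAction.fixedBy (Fin M → G ⧸ (Q : Subgroup G)) u ≃
          (Fin M → MulAction.fixedBy (G ⧸ (Q : Subgroup G)) u) :=
        { toFun := fun x i ↦ ⟨x.1 i, congrFun x.2 i⟩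
          invFun := fun x ↦ ⟨fun i ↦ (x i).1, funext fun i ↦ (x i).2⟩
          left_inv := fun _ ↦ rfl
          right_inv := fun _ ↦ rfl }
      rw [Nat.card_congr e, Nat.card_fun, Nat.card_fin]
    rw [h1]
    refine Nat.ModEq.pow_totient (Nat.Coprime.pow_right _ ((Nat.coprime_comm).1
      ((Nat.Prime.coprime_iff_not_dvd hp).2 fun h2 ↦ ?_)))
    have h3 := hu.card_modEq_card_fixedPoints (G ⧸ (Q : Subgroup G))
    have h4 : MulAction.fixedPoints (Subgroup.zpowers u) (G ⧸ (Q : Subgroup G)) =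
        MulAction.fixedBy (G ⧸ (Q : Subgroup G)) u := by
      ext x
      rw [MulAction.mem_fixedPoints, MulAction.mem_fixedBy]
      refine ⟨fun h ↦ h ⟨u, Subgroup.mem_zpowers u⟩, fun h ⟨v, hv⟩ ↦ ?_⟩
      obtain ⟨k, rfl⟩ := hv
      exact (MulAction.mem_stabilizer_iff.1
        ((MulAction.stabilizer G x).zpow_mem (MulAction.mem_stabilizer_iff.2 h) k))
    rw [h4] at h3
    exact Q.not_dvd_index ((Nat.ModEq.dvd_iff h3 dvd_rfl).2 h2)

/-- `G × X` with `G` acting by conjugation on the first factor. -/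
@[ext]
structure ConjProd (G X : Type) where
  /-- The group component. -/
  fst : G
  /-- The `G`-set component. -/
  snd : X

namespace ConjProd
variable {G X : Type}

/-- The underlying pair. -/
def equivProd : ConjProd G X ≃ G × X where
  toFun ω := (ω.fst, ω.snd)
  invFun a := ⟨a.1, a.2⟩

instance [Fintype G] [Fintype X] : Fintype (ConjProd G X) := Fintype.ofEquiv _ equivProd.symm

variable [Group G] [MulAction G X]

instance : MulAction G (ConjProd G X) where
  smul g ω := ⟨g * ω.fst * g⁻¹, g • ω.snd⟩
  one_smul ω := ConjProd.ext (by show 1 * ω.fst * 1⁻¹ = ω.fst; group) (one_smul G ω.snd)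
  mul_smul g h ω := ConjProd.ext
    (by show g * h * ω.fst * (g * h)⁻¹ = g * (h * ω.fst * h⁻¹) * g⁻¹; group)
    (mul_smul g h ω.snd)

theorem smul_def (g : G) (ω : ConjProd G X) : g • ω = ⟨g * ω.fst * g⁻¹, g • ω.snd⟩ := rfl

theorem mem_stabilizer {g : G} {ω : ConjProd G X} :
    g ∈ MulAction.stabilizer G ω ↔ Commute g ω.fst ∧ g ∈ MulAction.stabilizer G ω.snd := by
  rw [MulAction.mem_stabilizer_iff, MulAction.mem_stabilizer_iff, smul_def]
  refine ConjProd.ext_iff.trans (and_congr ?_ Iff.rfl)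
  exact mul_inv_eq_iff_eq_mul

end ConjProd

theorem isPiNumber_singleton_of_isPGroup {G : Type} [Group G] [Finite G] {p : ℕ}
    (hp : p.Prime) {P : Subgroup G} (hP : IsPGroup p P) {u : G} (hu : u ∈ P) :
    IsPiNumber {p} (orderOf u) := by
  have := Fact.mk hp
  obtain ⟨k, hk⟩ := (IsPGroup.iff_orderOf.1 hP) ⟨u, hu⟩
  rw [Subgroup.orderOf_mk] at hk
  exact fun q hq h ↦ (Nat.prime_dvd_prime_iff_eq hq hp).1 (hq.dvd_of_dvd_pow (hk ▸ h))

theorem isPGroup_zpowers_of_isPiNumber {G : Type} [Group G] [Finite G] {p : ℕ} {u : G}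
    (hu : IsPiNumber {p} (orderOf u)) : IsPGroup p (Subgroup.zpowers u) := by
  refine IsPGroup.of_card (n := (orderOf u).primeFactorsList.length) ?_
  rw [Nat.card_zpowers]
  exact Nat.eq_prime_pow_of_unique_prime_dvd (orderOf_pos u).ne' fun {_} hq h ↦ hu _ hq h

theorem isPiNumber_compl_singleton_iff {p n : ℕ} (hp : p.Prime) :
    IsPiNumber {p}ᶜ n ↔ ¬ p ∣ n :=
  ⟨fun h h1 ↦ h p hp h1 rfl, fun h _ _ hqn hqp ↦ h (hqp ▸ hqn)⟩

/-- The average of an algebraic-integer-valued class function is `p`-integral as soon as its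
averages over all translates `P y`, with `P` a `p`-group centralizing a `p'`-element `y`, are. -/
theorem PInt.average_of_local {G : Type} [Group G] [Fintype G] {p : ℕ} (hp : p.Prime) {f : G → ℂ}
    (hf : ∀ g h, f (h * g * h⁻¹) = f g) (hfint : ∀ g, IsIntegral ℤ (f g))
    (hloc : ∀ (y : G) (P : Subgroup G), ¬ p ∣ orderOf y → IsPGroup p P →
      (∀ u ∈ P, Commute u y) → PInt p ((Nat.card P : ℂ)⁻¹ * ∑ᶠ u : P, f (u * y))) :
    PInt p ((Nat.card G : ℂ)⁻¹ * ∑ g, f g) := by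
  classical
  obtain ⟨X, _, _, hstab, hfix⟩ := exists_gset_card_fixedBy_modEq_one (G := G) hp
  let c (g : G) : ℕ := Nat.card (MulAction.fixedBy X (elemPiPart {p} g))
  let W (ω : ConjProd G X) : ℂ := ∑ u : G,
    if u ∈ MulAction.stabilizer G ω ∧ ¬ p ∣ orderOf ω.fst then f (u * ω.fst) else 0
  have hW (g : G) (ω : ConjProd G X) : W (g • ω) = W ω := by
    refine (Fintype.sum_equiv (MulAut.conj g).toEquiv _ _ fun u ↦ ?_).symm
    have h1 : (MulAut.conj g u) ∈ MulAction.stabilizer G (g • ω) ↔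
        u ∈ MulAction.stabilizer G ω := by
      simp [MulAction.mem_stabilizer_iff, mul_smul]
    have h2 : orderOf (g • ω).fst = orderOf ω.fst := by
      show orderOf (MulAut.conj g ω.fst) = _
      exact orderOf_injective (MulAut.conj g).toMonoidHom (MulAut.conj g).injective _
    have h3 : f (MulAut.conj g u * (g • ω).fst) = f (u * ω.fst) := by
      rw [← hf (u * ω.fst) g]
      congr 1
      show g * u * g⁻¹ * (g * ω.fst * g⁻¹) = _
      group
    simp only [MulEquiv.toEquiv_eq_coe, MulEquiv.coe_toEquiv, h1, h2, h3]
  have hmain : PInt p ((Nat.card G : ℂ)⁻¹ * ∑ ω, W ω) := by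
    have h1 := PInt.average_stabilizer (G := G) (Ω := ConjProd G X) hp
      (w := fun ω ↦ (Nat.card (MulAction.stabilizer G ω) : ℂ)⁻¹ * W ω) (fun g ω ↦ ?_) fun ω ↦ ?_
    · convert h1 using 4 with ω
      rw [mul_inv_cancel_left₀ (NeZero.ne _)]
    · simp only [hW]
      congr 3
      rw [MulAction.stabilizer_smul_eq_stabilizer_map_conj]
      exact Nat.card_congr ((MulAction.stabilizer G ω).equivMapOfInjective _
        (MulAut.conj g).injective).toEquiv.symm
    · by_cases hy : p ∣ orderOf ω.fst
      · simpa [W, hy] using isIntegral_zero.pInt hp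
      · have h2 := hloc ω.fst (MulAction.stabilizer G ω) hy
          ((hstab ω.snd).to_le fun u hu ↦ (ConjProd.mem_stabilizer.1 hu).2)
          fun u hu ↦ (ConjProd.mem_stabilizer.1 hu).1
        convert h2 using 2
        rw [finsum_eq_sum_of_fintype]
        simp only [W, hy, not_false_eq_true, and_true]
        rw [← Finset.sum_filter]
        exact Finset.sum_subtype _ (fun u ↦ by simp) _
  have hsum : ∑ ω, W ω = ∑ g, f g * c g := by
    have h1 (x : X) : ∑ y : G, W ⟨y, x⟩ =
        ∑ g, if elemPiPart {p} g ∈ MulAction.stabilizer G x then f g else 0 := by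
      simp only [W]
      rw [← Fintype.sum_prod_type', ← Finset.sum_filter, ← Finset.sum_filter]
      have hkey (a : G × G) (ha : a.2 ∈ MulAction.stabilizer G (⟨a.1, x⟩ : ConjProd G X) ∧
          ¬ p ∣ orderOf a.1) : elemPiPart {p} (a.2 * a.1) = a.2 ∧
            elemPiPart {p}ᶜ (a.2 * a.1) = a.1 := by
        obtain ⟨h2, h3⟩ := ha
        obtain ⟨h4, h5⟩ := ConjProd.mem_stabilizer.1 h2
        have h6 := isPiNumber_singleton_of_isPGroup hp (hstab x) h5
        have h7 := (isPiNumber_compl_singleton_iff hp).2 h3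
        exact ⟨elemPiPart_mul h4 h6 h7, elemPiPart_compl_mul h4 h6 h7⟩
      refine Finset.sum_nbij' (fun a ↦ a.2 * a.1)
        (fun g ↦ (elemPiPart {p}ᶜ g, elemPiPart {p} g)) ?_ ?_ ?_ ?_ ?_
      · intro a ha
        have ha := (Finset.mem_filter.1 ha).2
        refine Finset.mem_filter.2 ⟨Finset.mem_univ _, ?_⟩
        rw [(hkey a ha).1]
        exact (ConjProd.mem_stabilizer.1 ha.1).2
      · intro g hg
        exact Finset.mem_filter.2 ⟨Finset.mem_univ _, ConjProd.mem_stabilizer.2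
          ⟨elemPiPart_commute _ g, (Finset.mem_filter.1 hg).2⟩,
          (isPiNumber_compl_singleton_iff hp).1 (elemPiPart_spec _ g).2.2.1⟩
      · intro a ha
        have ha := (Finset.mem_filter.1 ha).2
        exact Prod.ext (hkey a ha).2 (hkey a ha).1
      · exact fun g _ ↦ (elemPiPart_spec _ g).1
      · exact fun a _ ↦ rfl
    have h2 : ∑ ω, W ω = ∑ x : X, ∑ y : G, W ⟨y, x⟩ := by
      refine Eq.trans ?_ Finset.sum_comm
      rw [← Fintype.sum_prod_type' (fun (y : G) (x : X) ↦ W ⟨y, x⟩)]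
      exact Fintype.sum_equiv ConjProd.equivProd _ _ fun _ ↦ rfl
    rw [h2, Finset.sum_congr rfl fun x _ ↦ h1 x, Finset.sum_comm]
    refine Finset.sum_congr rfl fun g _ ↦ ?_
    rw [← Finset.sum_filter, Finset.sum_const, ← Nat.cast_smul_eq_nsmul ℂ, smul_eq_mul, mul_comm]
    congr 2
    simp only [c]
    rw [← Set.ncard_coe_finset, Nat.card_coe_set_eq]
    congr 1
    ext x
    simp [MulAction.mem_stabilizer_iff]
  have herr : PInt p ((Nat.card G : ℂ)⁻¹ * ∑ g, f g * (1 - c g)) := by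
    set a := (Nat.card G).factorization p with ha
    have h1 (g : G) : ∃ k : ℤ, (1 - c g : ℂ) = p ^ a * k := by
      have h2 := hfix (elemPiPart {p} g)
        (isPGroup_zpowers_of_isPiNumber (elemPiPart_spec {p} g).2.1)
      obtain ⟨k, hk⟩ := h2.dvd
      exact ⟨k, by exact_mod_cast hk⟩
    choose k hk using h1
    have hG : Nat.card G ≠ 0 := Nat.card_pos.ne'
    refine ⟨Nat.card G / p ^ a, Nat.not_dvd_ordCompl hp hG, ?_⟩
    have h3 : ((Nat.card G / p ^ a : ℕ) : ℂ) * ((Nat.card G : ℂ)⁻¹ * ∑ g, f g * (1 - c g)) =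
        ∑ g, f g * k g := by
      simp only [hk]
      have h4 : ((Nat.card G / p ^ a : ℕ) : ℂ) * p ^ a = Nat.card G := by
        exact_mod_cast Nat.div_mul_cancel (Nat.ordProj_dvd (Nat.card G) p)
      have h5 : ∑ g, f g * (p ^ a * k g) = p ^ a * ∑ g, f g * (k g : ℂ) := by
        rw [Finset.mul_sum]
        exact Finset.sum_congr rfl fun _ _ ↦ by ring
      rw [h5, mul_left_comm, ← mul_assoc _ _ (∑ g, f g * (k g : ℂ)), h4,
        inv_mul_cancel_left₀ (by exact_mod_cast hG)]
    rw [h3]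
    exact IsIntegral.sum _ fun g _ ↦ (hfint g).mul (isIntegral_intCast _)
  rw [hsum] at hmain
  have := hmain.add hp herr
  convert this using 1
  rw [← mul_add, ← Finset.sum_add_distrib]
  congr 1
  exact Finset.sum_congr rfl fun g _ ↦ by ring

end

section

open Module
namespace Representation

section
variable {H V W : Type*} [Group H] [Fintype H] [AddCommGroup W] [Module ℂ W]
  [FiniteDimensional ℂ W] [AddCommGroup V] [Module ℂ V] {σ : Representation ℂ H W}
  {ρ : Representation ℂ H V}

omit [Fintype H] in
theorem Irred.finrank_ne_zero (hσ : σ.Irred) : (finrank ℂ W : ℂ) ≠ 0 := by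
  have := hσ.1
  exact_mod_cast (finrank_pos (R := ℂ) (M := W)).ne'

theorem Irred.sum_conj (hσ : σ.Irred) (Y : Module.End ℂ W) :
    ∑ n, σ n * Y * σ n⁻¹ =
      ((Nat.card H : ℂ) * LinearMap.trace ℂ W Y / finrank ℂ W) • (1 : Module.End ℂ W) := by
  obtain ⟨c, hc⟩ := hσ.eq_smul_one (T := ∑ n, σ n * Y * σ n⁻¹) fun x ↦ by
    show _ * _ = _ * _
    rw [Finset.sum_mul, Finset.mul_sum]
    refine Fintype.sum_equiv (Equiv.mulLeft x⁻¹) _ _ fun n ↦ ?_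
    simp only [Equiv.coe_mulLeft, mul_inv_rev, inv_inv, map_mul, ← mul_assoc]
    rw [← map_mul, mul_inv_cancel, map_one, one_mul]
  have htr := congrArg (LinearMap.trace ℂ W) hc
  have h1 (n : H) : LinearMap.trace ℂ W (σ n * Y * σ n⁻¹) = LinearMap.trace ℂ W Y := by
    rw [LinearMap.trace_mul_comm, ← mul_assoc, ← map_mul, inv_mul_cancel, map_one, one_mul]
  rw [map_sum, Finset.sum_congr rfl fun n _ ↦ h1 n, map_smul, LinearMap.trace_one,
    Finset.sum_const, Finset.card_univ, ← Nat.card_eq_fintype_card, nsmul_eq_mul,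
    smul_eq_mul] at htr
  rw [hc, htr, mul_div_cancel_right₀ _ hσ.finrank_ne_zero]

theorem Irred.sum_trace_smul (hσ : σ.Irred) (X : Module.End ℂ W) :
    ∑ n, LinearMap.trace ℂ W (X * σ n⁻¹) • σ n = ((Nat.card H : ℂ) / finrank ℂ W) • X := by
  have hrank (φ : W →ₗ[ℂ] ℂ) (w : W) :
      ∑ n, LinearMap.trace ℂ W (φ.smulRight w * σ n⁻¹) • σ n =
        ((Nat.card H : ℂ) / finrank ℂ W) • φ.smulRight w := by
    ext v
    have h1 := LinearMap.congr_fun (hσ.sum_conj (φ.smulRight v)) w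
    have h2 (n : H) : LinearMap.trace ℂ W (φ.smulRight w * σ n⁻¹) = φ (σ n⁻¹ w) :=
      LinearMap.trace_smulRight (φ ∘ₗ σ n⁻¹) w
    simp only [LinearMap.sum_apply, LinearMap.smul_apply, h2, LinearMap.smulRight_apply]
    simp only [LinearMap.sum_apply, Module.End.mul_apply, LinearMap.smulRight_apply, map_smul,
      LinearMap.smul_apply, Module.End.one_apply, LinearMap.trace_smulRight] at h1
    rw [h1, smul_smul]
    ring_nf
  have hX : X = ∑ i, ((finBasis ℂ W).coord i).smulRight (X (finBasis ℂ W i)) := by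
    ext v
    have h1 := congrArg X ((finBasis ℂ W).sum_repr v)
    simp only [map_sum, map_smul] at h1
    simp [LinearMap.sum_apply, h1]
  rw [hX]
  simp only [Finset.sum_mul, map_sum, Finset.sum_smul, Finset.smul_sum]
  rw [Finset.sum_comm]
  exact Finset.sum_congr rfl fun i _ ↦ hrank _ _

variable (σ ρ) in
/-- The operator on a `σ`-isotypic representation `ρ` corresponding to an operator on `σ`. -/
def transfer : Module.End ℂ W →ₗ[ℂ] Module.End ℂ V where
  toFun X := ((finrank ℂ W : ℂ) / Nat.card H) • ∑ n, LinearMap.trace ℂ W (X * σ n⁻¹) • ρ n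
  map_add' X Y := by simp [add_mul, add_smul, Finset.sum_add_distrib]
  map_smul' c X := by
    simp only [smul_mul_assoc, map_smul, smul_eq_mul, mul_smul, ← Finset.smul_sum,
      RingHom.id_apply]
    exact smul_comm _ _ _

theorem Irred.transfer_comp (hσ : σ.Irred) (X : Module.End ℂ W) {u : W →ₗ[ℂ] V}
    (hu : ∀ n v, u (σ n v) = ρ n (u v)) (w : W) : transfer σ ρ X (u w) = u (X w) := by
  have h1 := congrArg u (LinearMap.congr_fun (hσ.sum_trace_smul X) w)
  simp only [LinearMap.sum_apply, LinearMap.smul_apply, map_sum, map_smul, hu] at h1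
  simp only [transfer, LinearMap.coe_mk, AddHom.coe_mk, LinearMap.sum_apply, LinearMap.smul_apply]
  rw [h1, smul_smul]
  have h2 : (Nat.card H : ℂ) ≠ 0 := NeZero.ne _
  have h3 := hσ.finrank_ne_zero
  rw [div_mul_div_comm, mul_comm, div_self (mul_ne_zero h2 h3), one_smul]

omit [FiniteDimensional ℂ W] in
theorem commute_transfer {T : Module.End ℂ V} (hT : ∀ n, Commute T (ρ n)) (X : Module.End ℂ W) :
    Commute T (transfer σ ρ X) :=
  (Commute.sum_right _ _ _ fun n _ ↦ (hT n).smul_right _).smul_right _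

variable (σ ρ) in
/-- `ρ` is a sum of copies of quotients of `σ`. -/
def Isotypic : Prop :=
  ⨆ u : {u : W →ₗ[ℂ] V // ∀ n v, u (σ n v) = ρ n (u v)}, LinearMap.range u.1 = ⊤

omit [Fintype H] [FiniteDimensional ℂ W] in
theorem Isotypic.ext (h : Isotypic σ ρ) {A B : Module.End ℂ V}
    (hAB : ∀ u : W →ₗ[ℂ] V, (∀ n v, u (σ n v) = ρ n (u v)) → ∀ w, A (u w) = B (u w)) :
    A = B := by
  rw [← sub_eq_zero, ← LinearMap.ker_eq_top, eq_top_iff, ← h]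
  refine iSup_le fun u ↦ ?_
  rintro _ ⟨w, rfl⟩
  rw [LinearMap.mem_ker, LinearMap.sub_apply, hAB u.1 u.2, sub_self]

theorem Irred.transfer_one (hσ : σ.Irred) (h : Isotypic σ ρ) : transfer σ ρ 1 = 1 :=
  h.ext fun u hu w ↦ by rw [hσ.transfer_comp _ hu, Module.End.one_apply, Module.End.one_apply]

theorem Irred.transfer_mul (hσ : σ.Irred) (h : Isotypic σ ρ) (X Y : Module.End ℂ W) :
    transfer σ ρ (X * Y) = transfer σ ρ X * transfer σ ρ Y :=
  h.ext fun u hu w ↦ by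
    simp only [Module.End.mul_apply, hσ.transfer_comp _ hu]

theorem Irred.transfer_apply (hσ : σ.Irred) (h : Isotypic σ ρ) (n : H) :
    transfer σ ρ (σ n) = ρ n :=
  h.ext fun u hu w ↦ by rw [hσ.transfer_comp _ hu, hu]

theorem Irred.trace_mul_transfer [FiniteDimensional ℂ V] (hσ : σ.Irred) (h : Isotypic σ ρ)
    {T : Module.End ℂ V} (hT : ∀ n, Commute T (ρ n)) (X : Module.End ℂ W) :
    LinearMap.trace ℂ V (T * transfer σ ρ X) * finrank ℂ W =
      LinearMap.trace ℂ V T * LinearMap.trace ℂ W X := by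
  have h1 (n : H) : LinearMap.trace ℂ V (T * transfer σ ρ (σ n * X * σ n⁻¹)) =
      LinearMap.trace ℂ V (T * transfer σ ρ X) := by
    rw [hσ.transfer_mul h, hσ.transfer_mul h, hσ.transfer_apply h, hσ.transfer_apply h,
      ← mul_assoc, LinearMap.trace_mul_comm, ← mul_assoc, ← mul_assoc, ← (hT _).eq, mul_assoc T,
      ← map_mul, inv_mul_cancel, map_one, mul_one]
  have h2 := congrArg (fun Y ↦ LinearMap.trace ℂ V (T * transfer σ ρ Y)) (hσ.sum_conj X)
  simp only [map_sum, Finset.mul_sum, h1, map_smul, mul_smul_comm, hσ.transfer_one h, mul_one,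
    Finset.sum_const, Finset.card_univ, ← Nat.card_eq_fintype_card, nsmul_eq_mul,
    smul_eq_mul] at h2
  have h3 : (Nat.card H : ℂ) ≠ 0 := NeZero.ne _
  have h4 := hσ.finrank_ne_zero
  rw [mul_div_assoc, mul_assoc] at h2
  rw [mul_left_cancel₀ h3 h2]
  field_simp

end
end Representation

end

section

open Module
namespace Representation

section
variable {G V W : Type*} [Group G] {N : Subgroup G} [N.Normal]
  [AddCommGroup W] [Module ℂ W] [FiniteDimensional ℂ W] [AddCommGroup V] [Module ℂ V]

/-- The pairs `(g, X)` with `X` an operator of determinant one intertwining `σ` with its conjugate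
by `g`. -/
def inertiaCover (σ : Representation ℂ N W) : Subgroup (G × (Module.End ℂ W)ˣ) where
  carrier := {γ | LinearMap.det (γ.2 : Module.End ℂ W) = 1 ∧
    ∀ n : N, (γ.2 : Module.End ℂ W) * σ n = σ (MulAut.conjNormal γ.1 n) * γ.2}
  one_mem' := ⟨by simp, fun n ↦ by simp⟩
  mul_mem' := by
    rintro ⟨g, X⟩ ⟨h, Y⟩ ⟨hX, hX'⟩ ⟨hY, hY'⟩
    refine ⟨by simp_all, fun n ↦ ?_⟩
    simp only [Prod.mk_mul_mk, Units.val_mul, map_mul, MulAut.mul_apply] at hX' hY' ⊢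
    rw [mul_assoc, hY', ← mul_assoc, hX', mul_assoc]
  inv_mem' := by
    rintro ⟨g, X⟩ ⟨hX, hX'⟩
    have h1 : LinearMap.det (X : Module.End ℂ W) *
        LinearMap.det (X⁻¹ : (Module.End ℂ W)ˣ).val = 1 := by
      rw [← map_mul, ← Units.val_mul, mul_inv_cancel, Units.val_one, map_one]
    refine ⟨?_, fun n ↦ ?_⟩
    · simp only at hX
      rwa [hX, one_mul] at h1
    · have h2 := hX' (MulAut.conjNormal g⁻¹ n)
      rw [← MulAut.mul_apply, ← map_mul, mul_inv_cancel, map_one, MulAut.one_apply] at h2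
      show (X⁻¹ : (Module.End ℂ W)ˣ).val * σ n =
        σ (MulAut.conjNormal g⁻¹ n) * (X⁻¹ : (Module.End ℂ W)ˣ).val
      rw [Units.inv_mul_eq_iff_eq_mul, ← mul_assoc, h2, Units.mul_inv_cancel_right]

variable {σ : Representation ℂ N W}

theorem exists_mem_inertiaCover [Finite G] (hσ : σ.Irred)
    (hinv : ∀ (g : G) n, σ.character (MulAut.conjNormal g n) = σ.character n) (g : G) :
    ∃ X, (g, X) ∈ inertiaCover σ := by
  let σg : Representation ℂ N W := σ.comp (MulAut.conjNormal g).toMonoidHom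
  have hσg : σg.Irred := ⟨hσ.1, fun p hp ↦ hσ.2 p fun n v hv ↦ by
    have := hp ((MulAut.conjNormal g).symm n) v hv
    simpa [σg] using this⟩
  obtain ⟨e, he⟩ := hσ.exists_equiv hσg (funext fun n ↦ (hinv g n).symm)
  have hd : finrank ℂ W ≠ 0 := by exact_mod_cast hσ.finrank_ne_zero
  obtain ⟨c, hc⟩ := IsAlgClosed.exists_pow_nat_eq (LinearMap.det (e : W →ₗ[ℂ] W))⁻¹
    (Nat.pos_of_ne_zero hd)
  have hdet : LinearMap.det (e : W →ₗ[ℂ] W) ≠ 0 := (LinearEquiv.isUnit_det' e).ne_zero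
  have hc0 : c ≠ 0 := by
    rintro rfl
    rw [zero_pow hd] at hc
    exact inv_ne_zero hdet hc.symm
  let X : (Module.End ℂ W)ˣ :=
    ⟨c • (e : W →ₗ[ℂ] W), c⁻¹ • (e.symm : W →ₗ[ℂ] W), by ext; simp [hc0], by ext; simp [hc0]⟩
  refine ⟨X, ?_, fun n ↦ ?_⟩
  · show LinearMap.det (c • (e : W →ₗ[ℂ] W)) = 1
    rw [LinearMap.det_smul, hc, inv_mul_cancel₀ hdet]
  · ext v
    exact congrArg (c • ·) (he n v) |>.trans (by simp [X, σg])

theorem exists_smul_of_one_mem_inertiaCover (hσ : σ.Irred) {X : (Module.End ℂ W)ˣ}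
    (h : ((1 : G), X) ∈ inertiaCover σ) :
    ∃ c : ℂ, c ^ finrank ℂ W = 1 ∧ (X : Module.End ℂ W) = c • 1 := by
  obtain ⟨c, hc⟩ := hσ.eq_smul_one (T := (X : Module.End ℂ W)) fun n ↦ by
    show _ * _ = _ * _
    simpa using h.2 n
  refine ⟨c, ?_, hc⟩
  have := h.1
  simp only [hc, LinearMap.det_smul, map_one, mul_one] at this
  exact this

theorem finite_inertiaCover [Finite G] (hσ : σ.Irred) : Finite (inertiaCover σ) := by
  let π : inertiaCover σ →* G := (MonoidHom.fst _ _).comp (inertiaCover σ).subtype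
  have hd : finrank ℂ W ≠ 0 := by exact_mod_cast hσ.finrank_ne_zero
  have hker (γ : π.ker) : ∃ c : ℂ, c ^ finrank ℂ W = 1 ∧ (γ.1.1.2 : Module.End ℂ W) = c • 1 := by
    refine exists_smul_of_one_mem_inertiaCover (G := G) (N := N) hσ ?_
    have h1 : γ.1.1.1 = 1 := γ.2
    rw [← h1]
    exact γ.1.2
  choose c hc hc' using hker
  have hfin : Finite {z : ℂ // z ^ finrank ℂ W = 1} := by
    refine Set.Finite.subset (Polynomial.nthRootsFinset (finrank ℂ W) (1 : ℂ)).finite_toSet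
      fun z hz ↦ ?_
    exact (Polynomial.mem_nthRootsFinset (Nat.pos_of_ne_zero hd) 1).2 hz
  have : Finite π.ker := by
    refine Finite.of_injective (fun γ ↦ (⟨c γ, hc γ⟩ : {z : ℂ // z ^ finrank ℂ W = 1}))
      fun γ δ h ↦ ?_
    have h1 : c γ = c δ := congrArg Subtype.val h
    refine Subtype.ext (Subtype.ext (Prod.ext ?_ (Units.ext ?_)))
    · exact (show γ.1.1.1 = 1 from γ.2).trans (show δ.1.1.1 = 1 from δ.2).symm
    · rw [hc', hc', h1]
  have : Finite (inertiaCover σ ⧸ π.ker) :=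
    Finite.of_equiv _ (QuotientGroup.quotientKerEquivRange π).symm.toEquiv
  exact Finite.of_equiv _ (Subgroup.groupEquivQuotientProdSubgroup (s := π.ker)).symm

variable {ρ : Representation ℂ G V}

theorem isotypic_of_irred [Finite G] (hσ : σ.Irred)
    (hinv : ∀ (g : G) n, σ.character (MulAut.conjNormal g n) = σ.character n) (hρ : ρ.Irred)
    (hne : ∃ u : W →ₗ[ℂ] V, (∀ (n : N) v, u (σ n v) = ρ n (u v)) ∧ u ≠ 0) :
    Isotypic σ (ρ.comp N.subtype) := by
  refine (hρ.2 _ fun g v hv ↦ ?_).resolve_left fun h ↦ ?_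
  · obtain ⟨X, -, hX⟩ := exists_mem_inertiaCover hσ hinv g⁻¹
    simp only at hX
    induction hv using Submodule.iSup_induction' with
    | mem u v hv =>
      obtain ⟨w, rfl⟩ := hv
      let u' : W →ₗ[ℂ] V := ρ g ∘ₗ u.1 ∘ₗ (X : Module.End ℂ W)
      have hu' (n : N) (w : W) : u' (σ n w) = ρ n (u' w) := by
        have h1 := LinearMap.congr_fun (hX n) w
        simp only [Module.End.mul_apply] at h1
        have h2 : ρ g * ρ (MulAut.conjNormal g⁻¹ n : N) = ρ n * ρ g := by
          rw [← map_mul, ← map_mul, MulAut.conjNormal_apply]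
          group
        simp only [u', LinearMap.comp_apply, h1, u.2]
        exact LinearMap.congr_fun h2 _
      refine Submodule.mem_iSup_of_mem ⟨u', hu'⟩ ⟨(X⁻¹ : (Module.End ℂ W)ˣ).val w, ?_⟩
      have h3 : (X : Module.End ℂ W) ((X⁻¹ : (Module.End ℂ W)ˣ).val w) = w := by
        rw [← Module.End.mul_apply, Units.mul_inv, Module.End.one_apply]
      simp [u', h3]
    | zero => simp
    | add v w _ _ hv hw => rw [map_add]; exact add_mem hv hw
  · obtain ⟨u, hu, hu0⟩ := hne
    refine hu0 (LinearMap.range_eq_bot.1 (eq_bot_iff.2 (h ▸ ?_)))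
    exact le_iSup (fun u : {u : W →ₗ[ℂ] V // ∀ n v, u (σ n v) = ρ.comp N.subtype n (u v)} ↦
      LinearMap.range u.1) ⟨u, hu⟩

variable [Fintype N]

theorem commute_mul_transfer (hσ : σ.Irred) (h : Isotypic σ (ρ.comp N.subtype))
    {γ : G × (Module.End ℂ W)ˣ} (hγ : γ ∈ inertiaCover σ) (n : N) :
    Commute (ρ γ.1 * transfer σ (ρ.comp N.subtype) (γ.2⁻¹ : (Module.End ℂ W)ˣ).val) (ρ n) := by
  have h1 := ((inertiaCover σ).inv_mem hγ).2 n
  have h2 := congrArg (transfer σ (ρ.comp N.subtype)) h1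
  simp only [hσ.transfer_mul h, hσ.transfer_apply h, Prod.fst_inv, Prod.snd_inv] at h2
  show _ * _ * _ = _ * (_ * _)
  have h3 : ρ γ.1 * ρ (MulAut.conjNormal γ.1⁻¹ n : N) = ρ n * ρ γ.1 := by
    rw [← map_mul, ← map_mul, MulAut.conjNormal_apply]
    group
  rw [mul_assoc, ← mul_assoc (ρ n), ← h3, mul_assoc]
  exact congrArg (ρ γ.1 * ·) h2

/-- The action of the inertia cover on the multiplicity space of `σ` in `ρ`, realized inside the
endomorphisms of `ρ`. -/
def multiplicityHom (hσ : σ.Irred) (h : Isotypic σ (ρ.comp N.subtype)) :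
    inertiaCover σ →* Module.End ℂ V where
  toFun γ := ρ γ.1.1 * transfer σ (ρ.comp N.subtype) (γ.1.2⁻¹ : (Module.End ℂ W)ˣ).val
  map_one' := by simp [hσ.transfer_one h]
  map_mul' γ δ := by
    have h1 := commute_transfer (σ := σ) (ρ := ρ.comp N.subtype)
      (commute_mul_transfer hσ h δ.2) (γ.1.2⁻¹ : (Module.End ℂ W)ˣ).val
    simp only [Subgroup.coe_mul, Prod.fst_mul, Prod.snd_mul, mul_inv_rev, Units.val_mul,
      hσ.transfer_mul h, map_mul]
    rw [mul_assoc (ρ γ.1.1) (transfer _ _ _), ← h1.eq]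
    simp only [mul_assoc]

theorem multiplicityHom_apply (hσ : σ.Irred) (h : Isotypic σ (ρ.comp N.subtype))
    (γ : inertiaCover σ) : multiplicityHom hσ h γ =
      ρ γ.1.1 * transfer σ (ρ.comp N.subtype) (γ.1.2⁻¹ : (Module.End ℂ W)ˣ).val := rfl

end
end Representation

end

section

open Module
namespace Representation

section
variable {G V W : Type*} [Group G] {N : Subgroup G} [N.Normal] [Fintype N]
  [AddCommGroup W] [Module ℂ W] [FiniteDimensional ℂ W] [AddCommGroup V] [Module ℂ V]
  {σ : Representation ℂ N W} {ρ : Representation ℂ G V}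

theorem multiplicityHom_conj (hσ : σ.Irred) (h : Isotypic σ (ρ.comp N.subtype))
    (γ δ : inertiaCover σ) : multiplicityHom hσ h (γ * δ * γ⁻¹) =
      ρ γ.1.1 * multiplicityHom hσ h δ * ρ γ.1.1⁻¹ := by
  have h1 : multiplicityHom hσ h γ * multiplicityHom hσ h δ =
      ρ γ.1.1 * multiplicityHom hσ h δ * ρ γ.1.1⁻¹ * multiplicityHom hσ h γ := by
    have h2 := commute_transfer (σ := σ) (ρ := ρ.comp N.subtype)
      (T := multiplicityHom hσ h δ)
      (commute_mul_transfer hσ h δ.2) (γ.1.2⁻¹ : (Module.End ℂ W)ˣ).val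
    rw [multiplicityHom_apply hσ h γ, mul_assoc, ← h2.eq, mul_assoc (ρ γ.1.1 * _),
      ← mul_assoc (ρ γ.1.1⁻¹), ← map_mul, inv_mul_cancel, map_one, one_mul, mul_assoc]
  rw [map_mul, map_mul, h1, mul_assoc, ← map_mul, mul_inv_cancel, map_one, mul_one]

theorem isIntegral_sum_multiplicityHom [Finite G] (hσ : σ.Irred)
    (h : Isotypic σ (ρ.comp N.subtype)) {ι : Type*} (s : Finset ι) (γ : ι → inertiaCover σ) :
    IsIntegral ℤ (∑ i ∈ s, multiplicityHom hσ h (γ i)) := by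
  have := finite_inertiaCover (G := G) hσ
  have h1 := (IsIntegral.of_finite ℤ (∑ i ∈ s, MonoidAlgebra.of ℤ (inertiaCover σ) (γ i))).map
    (MonoidAlgebra.lift ℤ (Module.End ℂ V) (inertiaCover σ) (multiplicityHom hσ h))
  simpa using h1

theorem exists_multiplicityHom_conj_eq_smul (hσ : σ.Irred)
    (h : Isotypic σ (ρ.comp N.subtype)) {γ δ : inertiaCover σ} (hc : Commute γ.1.1 δ.1.1) :
    ∃ c : ℂ, ρ γ.1.1 * multiplicityHom hσ h δ * ρ γ.1.1⁻¹ = c • multiplicityHom hσ h δ := by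
  set ε : inertiaCover σ := γ * δ * γ⁻¹ * δ⁻¹ with hε
  have h1 : ε.1.1 = 1 := by
    simp [hε, hc.eq]
  obtain ⟨c, -, hc⟩ := exists_smul_of_one_mem_inertiaCover (G := G) hσ (X := ε.1.2⁻¹)
    (by have := (ε⁻¹).2; rwa [Subgroup.coe_inv, ← Prod.mk.eta (p := (ε.1)⁻¹), Prod.fst_inv, h1,
        inv_one] at this)
  refine ⟨c, ?_⟩
  rw [← multiplicityHom_conj, show γ * δ * γ⁻¹ = ε * δ by simp [hε], map_mul,
    multiplicityHom_apply hσ h ε, h1, map_one, one_mul, hc, map_smul, hσ.transfer_one h,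
    smul_mul_assoc, one_mul]

/-- Summing the conjugates of an operator over the cosets of a subgroup that centralizes it yields
an operator commuting with the whole group. -/
theorem exists_sum_conj_commute [Finite G] (ρ : Representation ℂ G V) (K : Subgroup G)
    {T : Module.End ℂ V} (hT : ∀ k ∈ K, Commute (ρ k) T) :
    ∃ r : Finset G, r.card = K.index ∧ ∀ g, Commute (∑ x ∈ r, ρ x * T * ρ x⁻¹) (ρ g) := by
  classical
  have := Fintype.ofFinite (G ⧸ K)
  have hK (g k : G) (hk : k ∈ K) : ρ (g * k) * T * ρ (g * k)⁻¹ = ρ g * T * ρ g⁻¹ := by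
    rw [map_mul, mul_inv_rev, map_mul, mul_assoc (ρ g), (hT k hk).eq, mul_assoc, mul_assoc,
      ← mul_assoc (ρ k), ← map_mul, mul_inv_cancel, map_one, one_mul, mul_assoc]
  have hout (g : G) : ρ (g : G ⧸ K).out * T * ρ (g : G ⧸ K).out⁻¹ = ρ g * T * ρ g⁻¹ := by
    obtain ⟨k, hk⟩ := QuotientGroup.mk_out_eq_mul K g
    rw [hk, hK _ _ k.2]
  refine ⟨Finset.univ.image (Quotient.out : G ⧸ K → G), ?_, fun g ↦ ?_⟩
  · rw [Finset.card_image_of_injective _ (Quotient.out_injective), Finset.card_univ,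
      ← Nat.card_eq_fintype_card]
    rfl
  · rw [Finset.sum_image (Quotient.out_injective.injOn)]
    show _ * _ = _ * _
    rw [Finset.sum_mul, Finset.mul_sum]
    refine Fintype.sum_equiv (MulAction.toPerm g⁻¹ : Equiv.Perm (G ⧸ K)) _ _ fun q ↦ ?_
    obtain ⟨x, rfl⟩ := QuotientGroup.mk_surjective q
    rw [MulAction.toPerm_apply, MulAction.Quotient.smul_coe, hout, hout]
    simp only [smul_eq_mul, mul_inv_rev, inv_inv, map_mul, ← mul_assoc]
    rw [← map_mul ρ g, mul_inv_cancel, map_one, one_mul]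

theorem Irred.exists_isIntegral_character_mul_index [Finite G] [FiniteDimensional ℂ V]
    (hσ : σ.Irred)
    (hinv : ∀ (g : G) n, σ.character (MulAut.conjNormal g n) = σ.character n) (hρ : ρ.Irred)
    (hne : ∃ u : W →ₗ[ℂ] V, (∀ (n : N) v, u (σ n v) = ρ n (u v)) ∧ u ≠ 0) {m : ℕ}
    (hm : finrank ℂ V = finrank ℂ W * m) {y : G} {P : Subgroup G} (hP : ∀ u ∈ P, Commute u y) :
    ∃ t : ℂ, IsIntegral ℤ t ∧ ρ.character y * (P ⊔ N).index = t * m := by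
  have h := isotypic_of_irred hσ hinv hρ hne
  have hfin := finite_inertiaCover (G := G) hσ
  obtain ⟨X, hX⟩ := exists_mem_inertiaCover hσ hinv y
  set δ : inertiaCover σ := ⟨(y, X), hX⟩ with hδ
  set T := multiplicityHom hσ h δ with hTdef
  have hTN (n : N) : Commute T (ρ n) := commute_mul_transfer hσ h δ.2 n
  have hy : ρ y = T * transfer σ (ρ.comp N.subtype) X := by
    rw [hTdef, multiplicityHom_apply, mul_assoc, ← hσ.transfer_mul h]
    simp [hδ, hσ.transfer_one h]
  have htr := hσ.trace_mul_transfer h hTN X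
  rw [← hy] at htr
  change ρ.character y * _ = _ at htr
  have hd := hσ.finrank_ne_zero
  by_cases h0 : LinearMap.trace ℂ V T = 0
  · rw [h0, zero_mul] at htr
    exact ⟨0, isIntegral_zero, by simp [(mul_eq_zero.1 htr).resolve_right hd]⟩
  have hTP : ∀ u ∈ P, Commute (ρ u) T := fun u hu ↦ by
    obtain ⟨Y, hY⟩ := exists_mem_inertiaCover hσ hinv u
    obtain ⟨c, hc⟩ := exists_multiplicityHom_conj_eq_smul hσ h (γ := ⟨(u, Y), hY⟩) (δ := δ)
      (hP u hu)
    simp only at hc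
    have h1 := congrArg (LinearMap.trace ℂ V) hc
    rw [LinearMap.trace_mul_comm, ← mul_assoc, ← map_mul, inv_mul_cancel, map_one, one_mul,
      map_smul, smul_eq_mul] at h1
    have hc1 : c = 1 := mul_right_cancel₀ h0 (h1.symm.trans (one_mul _).symm)
    rw [hc1, one_smul] at hc
    show _ * _ = _ * _
    conv_rhs => rw [hTdef, ← hc]
    rw [mul_assoc _ (ρ u⁻¹), ← map_mul, inv_mul_cancel, map_one, mul_one]
  have hTK : ∀ k ∈ P ⊔ N, Commute (ρ k) T := fun k hk ↦ by
    rw [Subgroup.mem_sup_of_normal_right] at hk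
    obtain ⟨u, hu, n, hn, rfl⟩ := hk
    rw [map_mul]
    exact (hTP u hu).mul_left (hTN ⟨n, hn⟩).symm
  obtain ⟨r, hr, hS⟩ := exists_sum_conj_commute ρ (P ⊔ N) hTK
  obtain ⟨s, hs⟩ := hρ.eq_smul_one hS
  have hsint : IsIntegral ℤ s := by
    choose Y hY using exists_mem_inertiaCover (G := G) hσ hinv
    have h1 := isIntegral_sum_multiplicityHom hσ h r
      fun g ↦ (⟨(g, Y g), hY g⟩ : inertiaCover σ) * δ * (⟨(g, Y g), hY g⟩ : inertiaCover σ)⁻¹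
    simp only [multiplicityHom_conj] at h1
    rw [hs, ← Algebra.algebraMap_eq_smul_one] at h1
    have := hρ.1
    exact (isIntegral_algebraMap_iff (FaithfulSMul.algebraMap_injective ℂ _)).1 h1
  have hXint : IsIntegral ℤ (LinearMap.trace ℂ W X) := by
    refine isIntegral_trace_of_isIntegral (isIntegral_of_pow_eq_one' (N := orderOf δ)
      (orderOf_pos δ).ne' ?_)
    exact congrArg (fun γ : inertiaCover σ ↦ (γ.1.2 : Module.End ℂ W)) (pow_orderOf_eq_one δ)
  refine ⟨s * LinearMap.trace ℂ W X, hsint.mul hXint, ?_⟩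
  have h2 := congrArg (LinearMap.trace ℂ V) hs
  have h3 (x : G) : LinearMap.trace ℂ V (ρ x * T * ρ x⁻¹) = LinearMap.trace ℂ V T := by
    rw [LinearMap.trace_mul_comm, ← mul_assoc, ← map_mul, inv_mul_cancel, map_one, one_mul]
  simp only [map_sum, h3, Finset.sum_const, hr, nsmul_eq_mul, map_smul, LinearMap.trace_one,
    smul_eq_mul, hm, Nat.cast_mul] at h2
  refine mul_right_cancel₀ hd ?_
  linear_combination ((P ⊔ N).index : ℂ) * htr + LinearMap.trace ℂ W X * h2

end
end Representation

end

section

theorem Nat.factorization_piPart {π : Set ℕ} {p : ℕ} (hp : p.Prime) (hpπ : p ∈ π) {n : ℕ}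
    (hn : n ≠ 0) : (Nat.piPart π n).factorization p = n.factorization p := by
  obtain ⟨a, b, rfl, ha, hb⟩ := Nat.exists_eq_mul_isPiNumber π n hn
  have ha0 := left_ne_zero_of_mul hn
  rw [Nat.piPart_mul ha0 ha hb, Nat.factorization_mul ha0 (right_ne_zero_of_mul hn),
    Finsupp.add_apply, Nat.factorization_eq_zero_of_not_dvd fun h ↦ hb p hp h hpπ, add_zero]

theorem PInt.div_of_mul_eq {p a : ℕ} {x t : ℂ} {r k m : ℕ} (ht : IsIntegral ℤ t)
    (h : x * k = t * m) (hp : p.Prime) (hkr : k * r ≠ 0)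
    (ha : (k * r).factorization p = a) (hma : m.factorization p = a) : PInt p (x / r) := by
  refine ⟨ordCompl[p] (k * r), Nat.not_dvd_ordCompl hp hkr, ?_⟩
  have h1 := Nat.ordProj_mul_ordCompl_eq_self (k * r) p
  have h2 := Nat.ordProj_mul_ordCompl_eq_self m p
  rw [ha] at h1 ⊢
  rw [hma] at h2
  have h3 : ((k * r / p ^ a : ℕ) : ℂ) * (x / r) = t * (m / p ^ a : ℕ) := by
    have h1' := congrArg (Nat.cast (R := ℂ)) h1
    have h2' := congrArg (Nat.cast (R := ℂ)) h2
    have hr : (r : ℂ) ≠ 0 := by exact_mod_cast right_ne_zero_of_mul hkr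
    have hpa : (p : ℂ) ^ a ≠ 0 := pow_ne_zero _ (by exact_mod_cast hp.ne_zero)
    rw [Nat.cast_mul, Nat.cast_pow] at h1' h2'
    rw [Nat.cast_mul] at h1'
    refine mul_left_cancel₀ hpa (mul_right_cancel₀ hr ?_)
    rw [show (p : ℂ) ^ a * (↑(k * r / p ^ a) * (x / ↑r)) * ↑r =
      (p : ℂ) ^ a * ↑(k * r / p ^ a) * x by field_simp, h1']
    linear_combination (r : ℂ) * h - (r : ℂ) * t * h2'
  rw [h3]
  exact ht.mul (isIntegral_natCast _)

namespace Representation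
open Module

section
variable {G V W : Type*} [Group G] [Finite G] {N : Subgroup G} [N.Normal]
  [AddCommGroup W] [Module ℂ W] [FiniteDimensional ℂ W] [AddCommGroup V] [Module ℂ V]
  [FiniteDimensional ℂ V] {σ : Representation ℂ N W} {ρ : Representation ℂ G V}

theorem Irred.pInt_character_div_relIndex (hσ : σ.Irred)
    (hinv : ∀ (g : G) n, σ.character (MulAut.conjNormal g n) = σ.character n) (hρ : ρ.Irred)
    (hne : ∃ u : W →ₗ[ℂ] V, (∀ (n : N) v, u (σ n v) = ρ n (u v)) ∧ u ≠ 0) {m : ℕ}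
    (hm : finrank ℂ V = finrank ℂ W * m) {p : ℕ} (hp : p.Prime)
    (hpm : m.factorization p = N.index.factorization p) {y : G} {P : Subgroup G}
    (hP : ∀ u ∈ P, Commute u y) : PInt p (ρ.character y / N.relIndex P) := by
  have := Fintype.ofFinite N
  obtain ⟨t, ht, h⟩ := hσ.exists_isIntegral_character_mul_index hinv hρ hne hm hP
  have h1 : (P ⊔ N).index * N.relIndex P = N.index := by
    rw [← Subgroup.relIndex_mul_index (le_sup_right : N ≤ P ⊔ N), sup_comm,
      Subgroup.relIndex_sup_left, mul_comm]
  refine PInt.div_of_mul_eq ht h hp ?_ rfl (h1 ▸ hpm)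
  rw [h1]
  exact Subgroup.index_ne_zero_of_finite

end

section
variable {G W : Type*} [Group G] {N : Subgroup G} [AddCommGroup W] [Module ℂ W]

open Classical in
/-- The character of a representation of a subgroup, extended by zero. -/
def extChar (σ : Representation ℂ N W) (g : G) : ℂ :=
  if h : g ∈ N then σ.character ⟨g, h⟩ else 0

variable {σ : Representation ℂ N W}

theorem extChar_of_mem {g : G} (h : g ∈ N) : extChar σ g = σ.character ⟨g, h⟩ := dif_pos h

theorem extChar_of_notMem {g : G} (h : g ∉ N) : extChar σ g = 0 := dif_neg h

theorem isIntegral_extChar [Finite G] [FiniteDimensional ℂ W] (g : G) :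
    IsIntegral ℤ (extChar σ g) := by
  by_cases h : g ∈ N
  · rw [extChar_of_mem h]
    exact isIntegral_character _ _
  · rw [extChar_of_notMem h]
    exact isIntegral_zero

theorem extChar_conj [N.Normal]
    (hinv : ∀ (g : G) n, σ.character (MulAut.conjNormal g n) = σ.character n) (g h : G) :
    extChar σ (h * g * h⁻¹) = extChar σ g := by
  by_cases hg : g ∈ N
  · rw [extChar_of_mem hg, extChar_of_mem (Subgroup.Normal.conj_mem ‹_› g hg h), ← hinv h ⟨g, hg⟩]
    rfl
  · rw [extChar_of_notMem hg, extChar_of_notMem]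
    rwa [← (Subgroup.Normal.mem_comm_iff ‹_›), inv_mul_cancel_left]

theorem isGaloisSeq_extChar [Finite G] [FiniteDimensional ℂ W] (g : G) :
    IsGaloisSeq (Nat.card G) fun k ↦ extChar σ (g ^ k) := by
  by_cases hg : g ∈ N
  · refine (IsGaloisSeq.character σ Nat.card_pos.ne' (g := ⟨g, hg⟩)
      (Subtype.ext (pow_card_eq_one' (x := g)))).congr fun k _ ↦ ?_
    rw [extChar_of_mem (N.pow_mem hg k)]
    rfl
  · refine (IsGaloisSeq.zero _).congr fun k hk ↦ extChar_of_notMem fun h ↦ hg ?_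
    rw [← zpow_one g]
    obtain ⟨l, hl⟩ := exists_pow_eq_self_of_coprime
      (hk.coprime_dvd_right (orderOf_dvd_natCard g) : k.Coprime (orderOf g))
    rw [zpow_one, ← hl]
    exact N.pow_mem h l

end

section
variable {G V W U : Type} [Group G] {N : Subgroup G}
  [AddCommGroup W] [Module ℂ W] [FiniteDimensional ℂ W] [AddCommGroup V] [Module ℂ V]
  [FiniteDimensional ℂ V] [AddCommGroup U] [Module ℂ U] [FiniteDimensional ℂ U]
  (π : Set ℕ) (σ : Representation ℂ N W) (ρ : Representation ℂ G V) (η : Representation ℂ G U)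

/-- The class function `g ↦ σ(g_π) ρ(g_π')`, where `σ` is extended by zero outside `N`. -/
def mixedChar (g : G) : ℂ := extChar σ (elemPiPart π g) * ρ.character (elemPiPart πᶜ g)

variable [Finite G] {π σ ρ}

omit [FiniteDimensional ℂ W] [FiniteDimensional ℂ V] in
theorem mixedChar_mul {u y : G} (h : Commute u y) (hu : IsPiNumber π (orderOf u))
    (hy : IsPiNumber πᶜ (orderOf y)) :
    mixedChar π σ ρ (u * y) = extChar σ u * ρ.character y := by
  rw [mixedChar, elemPiPart_mul h hu hy, elemPiPart_compl_mul h hu hy]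

omit [FiniteDimensional ℂ W] [FiniteDimensional ℂ V] in
theorem mixedChar_conj [N.Normal]
    (hinv : ∀ (g : G) n, σ.character (MulAut.conjNormal g n) = σ.character n) (g h : G) :
    mixedChar π σ ρ (h * g * h⁻¹) = mixedChar π σ ρ g := by
  rw [mixedChar, elemPiPart_conj, elemPiPart_conj, extChar_conj hinv, char_conj, mixedChar]

theorem isIntegral_mixedChar (g : G) : IsIntegral ℤ (mixedChar π σ ρ g) :=
  (isIntegral_extChar _).mul (isIntegral_character _ _)

theorem isGaloisSeq_mixedChar (g : G) :
    IsGaloisSeq (Nat.card G) fun k ↦ mixedChar π σ ρ (g ^ k) := by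
  simp only [mixedChar, elemPiPart_pow]
  exact (isGaloisSeq_extChar _).mul (.character ρ Nat.card_pos.ne' pow_card_eq_one')

omit [FiniteDimensional ℂ V] [Finite G] in
theorem pow_card_apply (g : G) : ρ g ^ Nat.card G = 1 := by
  rw [← map_pow, pow_card_eq_one', map_one]

/-- The local contribution at a prime outside `π`. -/
theorem isIntegral_average_mixedChar_of_notMem {p : ℕ} (hp : p.Prime) (hpπ : p ∉ π) {y : G}
    {P : Subgroup G} [Fintype P] (hP : IsPGroup p P) (hPy : ∀ u ∈ P, Commute u y) :
    IsIntegral ℤ ((Nat.card P : ℂ)⁻¹ *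
      ∑ u : P, mixedChar π σ ρ (u * y) * η.character (u * y)) := by
  obtain ⟨hy, hy1, hy2, ⟨i, hi⟩, j, hj⟩ := elemPiPart_spec π y
  set y1 := elemPiPart π y
  set y2 := elemPiPart πᶜ y
  have h12 : Commute y1 y2 := elemPiPart_commute π y
  have hu1 (u : P) : Commute (u : G) y1 := hi ▸ (hPy u u.2).pow_right i
  have hu2 (u : P) : Commute (u : G) y2 := hj ▸ (hPy u u.2).pow_right j
  have hPπ (u : P) : IsPiNumber πᶜ (orderOf (u : G)) := fun q hq h hqπ ↦ hpπ
    (isPiNumber_singleton_of_isPGroup hp hP u.2 q hq h ▸ hqπ)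
  have h1 (u : P) : mixedChar π σ ρ (u * y) = extChar σ y1 * ρ.character (u * y2) := by
    rw [← mixedChar_mul ((hu1 u).symm.mul_right h12) hy1 ((hPπ u).orderOf_mul (hu2 u) hy2),
      ← mul_assoc, ← (hu1 u).eq, mul_assoc, hy]
  have h2 := isIntegral_average_trace_mul_trace (P := P) (ρ.comp P.subtype) (η.comp P.subtype)
    (A := ρ y2) (B := η y) (fun u ↦ (hu2 u).map ρ) (fun u ↦ (hPy u u.2).map η)
    (Nat.card_pos (α := G)).ne' (pow_card_apply _) (pow_card_apply _)
  have h3 : (Nat.card P : ℂ)⁻¹ * ∑ u : P, mixedChar π σ ρ (u * y) * η.character (u * y) =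
      extChar σ y1 * ((Nat.card P : ℂ)⁻¹ * ∑ u : P,
        LinearMap.trace ℂ V (ρ.comp P.subtype u * ρ y2) *
          LinearMap.trace ℂ U (η.comp P.subtype u * η y)) := by
    rw [mul_left_comm, Finset.mul_sum (a := extChar σ y1)]
    refine congrArg _ (Finset.sum_congr rfl fun u _ ↦ ?_)
    rw [h1, mul_assoc, character, character, map_mul ρ, map_mul η]
    rfl
  rw [h3]
  exact (isIntegral_extChar _).mul h2

omit [FiniteDimensional ℂ V] in
/-- The local contribution at a prime in `π`. -/
theorem exists_average_mixedChar_of_mem {p : ℕ} (hp : p.Prime) (hpπ : p ∈ π) {y : G}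
    (hyp : ¬ p ∣ orderOf y) {P : Subgroup G} [Fintype P] (hP : IsPGroup p P)
    (hPy : ∀ u ∈ P, Commute u y) :
    ∃ z : ℂ, IsIntegral ℤ z ∧ (Nat.card P : ℂ)⁻¹ *
      ∑ u : P, mixedChar π σ ρ (u * y) * η.character (u * y) =
        ρ.character (elemPiPart πᶜ y) / N.relIndex P * z := by
  classical
  obtain ⟨hy, hy1, hy2, ⟨i, hi⟩, j, hj⟩ := elemPiPart_spec π y
  set y1 := elemPiPart π y
  set y2 := elemPiPart πᶜ y
  have h12 : Commute y1 y2 := elemPiPart_commute π y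
  have hu1 (u : P) : Commute (u : G) y1 := hi ▸ (hPy u u.2).pow_right i
  have hu2 (u : P) : Commute (u : G) y2 := hj ▸ (hPy u u.2).pow_right j
  have hPp (u : P) := isPiNumber_singleton_of_isPGroup hp hP u.2
  have hPπ (u : P) : IsPiNumber π (orderOf (u : G)) := fun q hq h ↦ by
    rw [hPp u q hq h]
    exact hpπ
  have h1 (u : P) : mixedChar π σ ρ (u * y) = extChar σ (u * y1) * ρ.character y2 := by
    rw [← mixedChar_mul ((hu2 u).mul_left h12) ((hPπ u).orderOf_mul (hu1 u) hy1) hy2,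
      mul_assoc, hy]
  have hmem (u : P) (h : (u : G) * y1 ∈ N) : (u : G) ∈ N ∧ y1 ∈ N := by
    have hy1p : IsPiNumber {p}ᶜ (orderOf y1) :=
      ((isPiNumber_compl_singleton_iff hp).2 hyp).of_dvd (hi ▸ orderOf_pow_dvd i)
    obtain ⟨-, -, -, ⟨k, hk⟩, -⟩ := elemPiPart_spec {p} ((u : G) * y1)
    rw [elemPiPart_mul (hu1 u) (hPp u) hy1p] at hk
    have huN : (u : G) ∈ N := by
      rw [hk]
      exact N.pow_mem h k
    exact ⟨huN, (N.mul_mem_cancel_left huN).1 h⟩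
  by_cases hy1N : y1 ∈ N
  · let M := N.subgroupOf P
    let f : M →* N := (P.subtype.comp M.subtype).codRestrict N fun u ↦ u.2
    have h2 := isIntegral_average_trace_mul_trace (P := M) (σ.comp f)
      (η.comp (P.subtype.comp M.subtype))
      (A := σ ⟨y1, hy1N⟩) (B := η y) (fun u ↦ (show Commute (f u) ⟨y1, hy1N⟩ from
        Subtype.ext (hu1 u.1)).map σ) (fun u ↦ (hPy u.1 u.1.2).map η)
      (Nat.card_pos (α := G)).ne' (by
        have h : (⟨y1, hy1N⟩ : N) ^ Nat.card G = 1 := Subtype.ext (pow_card_eq_one' (x := y1))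
        rw [← map_pow, h, map_one]) (pow_card_apply _)
    refine ⟨_, h2, ?_⟩
    have h3 : ∑ u : P, mixedChar π σ ρ (u * y) * η.character (u * y) =
        ∑ u : M, mixedChar π σ ρ (u.1 * y) * η.character (u.1 * y) := by
      rw [← Finset.sum_filter_of_ne (p := (· ∈ M)) fun u _ h ↦ ?_,
        Finset.sum_subtype (p := (· ∈ M)) _ (by simp)]
      by_contra hu
      rw [h1, extChar_of_notMem fun h' ↦ hu (hmem u h').1, zero_mul, zero_mul] at h
      exact h rfl
    have h4 : (Nat.card P : ℂ) = N.relIndex P * Nat.card M := by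
      rw [← Nat.cast_mul, ← Subgroup.index_mul_card M]
      rfl
    rw [h3, h4, mul_inv, div_eq_mul_inv, mul_assoc, mul_assoc, mul_left_comm (ρ.character y2),
      mul_left_comm (ρ.character y2), Finset.mul_sum (a := ρ.character y2)]
    refine congrArg _ (congrArg _ (Finset.sum_congr rfl fun u _ ↦ ?_))
    have h5 : extChar σ (u.1 * y1) = σ.character (f u * ⟨y1, hy1N⟩) :=
      extChar_of_mem (N.mul_mem u.2 hy1N)
    rw [h1, h5, mul_right_comm, mul_comm, character, character, character, map_mul σ, map_mul η]
    rfl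
  · refine ⟨0, isIntegral_zero, ?_⟩
    rw [mul_zero, Finset.sum_eq_zero, mul_zero]
    intro u _
    rw [h1, extChar_of_notMem fun h ↦ hy1N (hmem u h).2, zero_mul, zero_mul]

end
end Representation

end

section

namespace Representation
open Module
section
variable {G V W : Type} [Group G] {N : Subgroup G}
  [AddCommGroup W] [Module ℂ W] [FiniteDimensional ℂ W] [AddCommGroup V] [Module ℂ V]
  [FiniteDimensional ℂ V] {π : Set ℕ} {σ : Representation ℂ N W} {ρ : Representation ℂ G V}

theorem isGenChar_mixedChar [Finite G] [N.Normal]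
    (hinv : ∀ (g : G) n, σ.character (MulAut.conjNormal g n) = σ.character n)
    (hρ : ∀ p : ℕ, p.Prime → p ∈ π → ∀ (y : G) (P : Subgroup G), (∀ u ∈ P, Commute u y) →
      PInt p (ρ.character y / N.relIndex P)) : IsGenChar G (mixedChar π σ ρ) := by
  have := Fintype.ofFinite G
  refine isGenChar_of_forall_pairing_int (mixedChar_conj hinv) fun U _ _ _ η ↦ ?_
  obtain ⟨n, hn⟩ := exists_int_sum_of_isGaloisSeq
    (f := fun g ↦ mixedChar π σ ρ g * η.character g) fun g ↦
      (isGaloisSeq_mixedChar g).mul (.character η Nat.card_pos.ne' pow_card_eq_one')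
  have hint : IsIntegral ℤ ((Nat.card G : ℂ)⁻¹ * ∑ g, mixedChar π σ ρ g * η.character g) := by
    refine PInt.isIntegral_of_forall fun p hp ↦ PInt.average_of_local hp
      (fun g h ↦ by rw [mixedChar_conj hinv, char_conj])
      (fun g ↦ (isIntegral_mixedChar g).mul (isIntegral_character η g)) fun y P hy hP hPy ↦ ?_
    have := Fintype.ofFinite P
    rw [finsum_eq_sum_of_fintype]
    by_cases hpπ : p ∈ π
    · obtain ⟨z, hz, h⟩ := exists_average_mixedChar_of_mem η hp hpπ hy hP hPy
        (σ := σ) (ρ := ρ)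
      rw [h]
      obtain ⟨-, -, -, -, j, hj⟩ := elemPiPart_spec π y
      exact (hρ p hp hpπ _ P fun u hu ↦ hj ▸ (hPy u hu).pow_right j).mul hp (hz.pInt hp)
    · exact (isIntegral_average_mixedChar_of_notMem η hp hpπ hP hPy).pInt hp
  rw [hn] at hint ⊢
  exact Complex.exists_int_of_isIntegral_div hint

end
end Representation

theorem charInner_character {G V W : Type} [Group G] [Fintype G] [AddCommGroup V] [Module ℂ V]
    [FiniteDimensional ℂ V] [AddCommGroup W] [Module ℂ W] [FiniteDimensional ℂ W]
    (σ : Representation ℂ G W) (ρ : Representation ℂ G V) :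
    charInner G σ.character ρ.character =
      (Nat.card G : ℂ)⁻¹ * ∑ g, σ.character g * ρ.character g⁻¹ := by
  simp only [charInner, finsum_eq_sum_of_fintype, Representation.char_inv_eq_conj]

theorem IsIrrChar.exists_irred {G : Type} [Group G] [Finite G] {χ : G → ℂ} (h : IsIrrChar G χ) :
    ∃ (V : Type) (_ : AddCommGroup V) (_ : Module ℂ V) (_ : FiniteDimensional ℂ V)
      (ρ : Representation ℂ G V), ρ.Irred ∧ χ = ρ.character := by
  have := Fintype.ofFinite G
  obtain ⟨⟨V, hV⟩, h1⟩ := h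
  have hχ : χ = Representation.character V.ρ := funext hV
  refine ⟨V, inferInstance, inferInstance, inferInstance, V.ρ, ?_, hχ⟩
  rw [hχ, charInner_character] at h1
  exact Representation.irred_of_char_norm_one h1

end

open Classical in
theorem psi_is_generalized_character
    {G : Type} [Group G] [Finite G] (π : Set ℕ) (N : Subgroup G) [N.Normal]
    (hNpi : IsPiNumber π (Nat.card ↥N))
    (θ μ : ↥N → ℂ) (hθ : IsIrrChar ↥N θ) (hμ : IsIrrChar ↥N μ)
    (hinvθ : IsGInvariant N θ) (hinvμ : IsGInvariant N μ)
    (χ : G → ℂ) (hχ : IsIrrChar G χ)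
    (hover : charInner ↥N (fun n : ↥N => χ (n : G)) μ ≠ 0)
    (hdef : ∃ m : ℕ, χ 1 = μ 1 * (m : ℂ) ∧ Nat.piPart π m = Nat.piPart π N.index) :
    IsGenChar G (fun g : G =>
      if h : elemPiPart π g ∈ N then θ ⟨elemPiPart π g, h⟩ * χ (elemPiPart πᶜ g)
      else 0) := by
  have := Fintype.ofFinite N
  obtain ⟨U, _, _, _, τ, -, rfl⟩ := hθ.exists_irred
  obtain ⟨W, _, _, _, σ, hσ, rfl⟩ := hμ.exists_irred
  obtain ⟨V, _, _, _, ρ, hρ, rfl⟩ := hχ.exists_irred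
  obtain ⟨m, hm, hmπ⟩ := hdef
  have hm' : Module.finrank ℂ V = Module.finrank ℂ W * m := by
    rw [Representation.char_one, Representation.char_one] at hm
    exact_mod_cast hm
  have hm0 : m ≠ 0 := by
    have h : Module.finrank ℂ V ≠ 0 := by exact_mod_cast hρ.finrank_ne_zero
    exact right_ne_zero_of_mul (hm' ▸ h)
  have hne : ∃ u : W →ₗ[ℂ] V, (∀ (n : N) v, u (σ n v) = ρ n (u v)) ∧ u ≠ 0 := by
    refine Representation.exists_intertwining_ne_zero (ρ := σ) (σ := ρ.comp N.subtype) ?_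
    rw [← charInner_character]
    exact hover
  have h := Representation.isGenChar_mixedChar (π := π) (σ := τ) (ρ := ρ) hinvθ
    fun p hp hpπ y P hP ↦ hσ.pInt_character_div_relIndex hinvμ hρ hne hm' hp (by
      rw [← Nat.factorization_piPart hp hpπ hm0, hmπ,
        Nat.factorization_piPart hp hpπ Subgroup.index_ne_zero_of_finite]) hP
  convert h using 1
  funext g
  rw [Representation.mixedChar, Representation.extChar]
  split_ifs <;> simp
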